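/- Let n > 1 and let q₁, q₂ : ℝⁿ → ℝ be smooth functions supported in the closed unit ball B̄ which are even in the last variable: qᵢ(y,z) = qᵢ(y,−z) for all (y,z) ∈ ℝⁿ, i = 1,2. For i = 1,2 suppose uᵢ is a smooth function on {(x,t) ∈ ℝⁿ×ℝ : t ≥ z} satisfying ∂ₜ²uᵢ − Δₓuᵢ + qᵢ·uᵢ = 0 on {t > z}, uᵢ(y,z,z) = −(1/2)∫_{−∞}^{z} qᵢ(y,s) ds for all (y,z) ∈ ℝⁿ, and uᵢ(x,t) = 0 whenever z ≤ t < −1. Let T > 6 and Σ_l = {(y,z,t) : (y,z) ∈ S, t ≤ T, t ≥ z}. If u₁ = u₂ on Σ_l, then q₁ = q₂ on ℝⁿ. -/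

import Mathlib

open MeasureTheory

/-- Second directional derivative of `f` at `p` in direction `v`. -/
noncomputable def dir2 {E : Type*} [NormedAddCommGroup E] [NormedSpace ℝ E]
    (f : E → ℝ) (p v : E) : ℝ :=
  iteratedDeriv 2 (fun s : ℝ => f (p + s • v)) 0

/-- The wave operator `□u = ∂ₜ²u − Δₓu` acting on functions of
`((y,z),t) ∈ (ℝ^m × ℝ) × ℝ` (so the space variable is `x = (y,z) ∈ ℝⁿ`, `n = m+1`). -/
noncomputable def waveOp (m : ℕ) (u : (EuclideanSpace ℝ (Fin m) × ℝ) × ℝ → ℝ)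
    (p : (EuclideanSpace ℝ (Fin m) × ℝ) × ℝ) : ℝ :=
  dir2 u p (0, 1)
    - ((∑ i : Fin m, dir2 u p ((EuclideanSpace.single i 1, 0), 0))
        + dir2 u p (((0 : EuclideanSpace ℝ (Fin m)), (1 : ℝ)), 0))

namespace FixedAngle

open Set Filter
open scoped ContDiff Topology

set_option linter.unusedSectionVars false

section HalfSpace

variable {X : Type*} [NormedAddCommGroup X] [NormedSpace ℝ X]

/-- The closed half space `{s ≥ 0}` of `X × ℝ`. -/
def halfSpace (X : Type*) : Set (X × ℝ) := {p | 0 ≤ p.2}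

/-- The open half space `{s > 0}` of `X × ℝ`. -/
def openHalf (X : Type*) : Set (X × ℝ) := {p | 0 < p.2}

theorem openHalf_subset : openHalf X ⊆ halfSpace X :=
  fun p (h : 0 < p.2) => show 0 ≤ p.2 from h.le

theorem isOpen_openHalf : IsOpen (openHalf X) := isOpen_lt continuous_const continuous_snd

theorem isClosed_halfSpace : IsClosed (halfSpace X) := isClosed_le continuous_const continuous_snd

theorem convex_halfSpace : Convex ℝ (halfSpace X) := by
  intro p hp q hq a b ha hb _
  have h1 : 0 ≤ p.2 := hp
  have h2 : 0 ≤ q.2 := hq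
  change 0 ≤ a * p.2 + b * q.2
  positivity

theorem openHalf_subset_interior : openHalf X ⊆ interior (halfSpace X) :=
  interior_maximal openHalf_subset isOpen_openHalf

theorem uniqueDiffOn_halfSpace : UniqueDiffOn ℝ (halfSpace X) :=
  uniqueDiffOn_convex convex_halfSpace
    ⟨((0 : X), (1 : ℝ)), openHalf_subset_interior (show (0 : ℝ) < 1 by norm_num)⟩

theorem halfSpace_mem_nhds {p : X × ℝ} (hp : 0 < p.2) : halfSpace X ∈ 𝓝 p :=
  mem_of_superset (isOpen_openHalf.mem_nhds hp) openHalf_subset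

/-- Directional derivative in the closed half space. -/
noncomputable def D (v : X × ℝ) (F : X × ℝ → ℝ) (p : X × ℝ) : ℝ :=
  fderivWithin ℝ F (halfSpace X) p v

/-- Smoothness up to the boundary of the half space. -/
def SmoothHalf (F : X × ℝ → ℝ) : Prop := ContDiffOn ℝ ∞ F (halfSpace X)

theorem SmoothHalf.D {F : X × ℝ → ℝ} (hF : SmoothHalf F) (v : X × ℝ) : SmoothHalf (D v F) :=
  (ContDiffOn.fderivWithin hF uniqueDiffOn_halfSpace (by simp)).clm_apply contDiffOn_const

theorem SmoothHalf.differentiableOn {F : X × ℝ → ℝ} (hF : SmoothHalf F) :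
    DifferentiableOn ℝ F (halfSpace X) :=
  ContDiffOn.differentiableOn hF (by simp)

theorem SmoothHalf.continuousOn {F : X × ℝ → ℝ} (hF : SmoothHalf F) :
    ContinuousOn F (halfSpace X) := ContDiffOn.continuousOn hF

theorem SmoothHalf.of_contDiff {F : X × ℝ → ℝ} (hF : ContDiff ℝ ∞ F) : SmoothHalf F :=
  hF.contDiffOn

theorem SmoothHalf.hasLineDerivAt {F : X × ℝ → ℝ} (hF : SmoothHalf F) {p : X × ℝ}
    (hp : 0 < p.2) (v : X × ℝ) : HasLineDerivAt ℝ F (FixedAngle.D v F p) p v := by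
  have h := ((hF.differentiableOn p (openHalf_subset hp)).hasFDerivWithinAt).hasFDerivAt
    (halfSpace_mem_nhds hp)
  exact h.hasLineDerivAt v

/-- Horizontal lines stay in the half space, so one-sidedness plays no role along them. -/
theorem SmoothHalf.hasLineDerivAt_horizontal {F : X × ℝ → ℝ} (hF : SmoothHalf F) {p : X × ℝ}
    (hp : 0 ≤ p.2) (v : X) : HasLineDerivAt ℝ F (FixedAngle.D (v, 0) F p) p (v, 0) := by
  have h := (hF.differentiableOn p hp).hasFDerivWithinAt
  have h2 := h.hasLineDerivWithinAt (v, 0)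
  unfold HasLineDerivWithinAt at h2
  have : (fun t : ℝ => p + t • ((v, 0) : X × ℝ)) ⁻¹' halfSpace X = univ := by
    ext t; simp [halfSpace, hp]
  rw [this, hasDerivWithinAt_univ] at h2
  exact h2

theorem SmoothHalf.D_eq {F : X × ℝ → ℝ} (hF : SmoothHalf F) {p : X × ℝ} (hp : 0 < p.2)
    {v : X × ℝ} {c : ℝ} (h : HasLineDerivAt ℝ F c p v) : FixedAngle.D v F p = c :=
  HasDerivAt.unique (hF.hasLineDerivAt hp v) h

theorem SmoothHalf.D_eq_horizontal {F : X × ℝ → ℝ} (hF : SmoothHalf F) {p : X × ℝ} (hp : 0 ≤ p.2)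
    {v : X} {c : ℝ} (h : HasLineDerivAt ℝ F c p (v, 0)) : FixedAngle.D (v, 0) F p = c :=
  HasDerivAt.unique (hF.hasLineDerivAt_horizontal hp v) h

theorem D_eqOn {F G : X × ℝ → ℝ} {O : Set (X × ℝ)} (hO : IsOpen O) (v : X × ℝ)
    (h : ∀ p ∈ O, p ∈ halfSpace X → F p = G p) :
    ∀ p ∈ O, p ∈ halfSpace X → D v F p = D v G p := by
  intro p hp hpH
  have : F =ᶠ[𝓝[halfSpace X] p] G := by
    filter_upwards [mem_nhdsWithin_of_mem_nhds (hO.mem_nhds hp), self_mem_nhdsWithin] with q h1 h2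
    exact h q h1 h2
  unfold D
  rw [this.fderivWithin_eq_of_mem hpH]

theorem D_zero_fun (v p : X × ℝ) : D v (fun _ => (0 : ℝ)) p = 0 := by
  simp [D]

theorem D_eq_zero_on {F : X × ℝ → ℝ} {O : Set (X × ℝ)} (hO : IsOpen O) (v : X × ℝ)
    (h : ∀ p ∈ O, p ∈ halfSpace X → F p = 0) :
    ∀ p ∈ O, p ∈ halfSpace X → D v F p = 0 := by
  intro p hp hpH
  rw [D_eqOn hO v (G := fun _ => 0) h p hp hpH, D_zero_fun]

theorem D_sub_dir (v w : X × ℝ) (F : X × ℝ → ℝ) (p : X × ℝ) :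
    D (v - w) F p = D v F p - D w F p := by simp [D]

theorem SmoothHalf.D_comm {F : X × ℝ → ℝ} (hF : SmoothHalf F) {p : X × ℝ} (hp : 0 < p.2)
    (v w : X × ℝ) : FixedAngle.D v (FixedAngle.D w F) p = FixedAngle.D w (FixedAngle.D v F) p := by
  have hp' : p ∈ halfSpace X := openHalf_subset hp
  have hsym := ContDiffWithinAt.isSymmSndFDerivWithinAt (hF p hp')
    (by simpa using (WithTop.coe_le_coe.2 le_top : ((2 : ℕ∞) : WithTop ℕ∞) ≤ ∞))
    uniqueDiffOn_halfSpace (subset_closure (openHalf_subset_interior hp)) hp'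
  have hd : DifferentiableWithinAt ℝ (fderivWithin ℝ F (halfSpace X)) (halfSpace X) p :=
    (ContDiffOn.fderivWithin hF uniqueDiffOn_halfSpace (m := ∞) (by simp)).differentiableOn
      (by simp) p hp'
  have key : ∀ a b : X × ℝ, FixedAngle.D a (FixedAngle.D b F) p =
      fderivWithin ℝ (fderivWithin ℝ F (halfSpace X)) (halfSpace X) p a b := by
    intro a b
    have := fderivWithin_clm_apply (uniqueDiffOn_halfSpace p hp') hd
      (differentiableWithinAt_const (c := b))
    change fderivWithin ℝ (fun q => fderivWithin ℝ F (halfSpace X) q b) (halfSpace X) p a = _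
    rw [this]
    simp
  rw [key, key]
  exact hsym v w

theorem SmoothHalf.dir2_eq {F : X × ℝ → ℝ} (hF : SmoothHalf F) {p : X × ℝ} (hp : 0 < p.2)
    (v : X × ℝ) :
    iteratedDeriv 2 (fun s : ℝ => F (p + s • v)) 0 = FixedAngle.D v (FixedAngle.D v F) p := by
  rw [iteratedDeriv_succ, iteratedDeriv_one]
  have hev : deriv (fun s : ℝ => F (p + s • v)) =ᶠ[𝓝 0]
      fun s => FixedAngle.D v F (p + s • v) := by
    have hc : Tendsto (fun s : ℝ => p + s • v) (𝓝 0) (𝓝 p) := by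
      have : Continuous (fun s : ℝ => p + s • v) := by fun_prop
      simpa using this.tendsto 0
    filter_upwards [hc (isOpen_openHalf.mem_nhds hp)] with s hs
    have h1 := hF.hasLineDerivAt (p := p + s • v) hs v
    unfold HasLineDerivAt at h1
    have h2 : HasDerivAt (fun r : ℝ => F (p + r • v)) (FixedAngle.D v F (p + s • v)) s := by
      have h3 : HasDerivAt (fun r : ℝ => r - s) 1 s := by
        simpa using (hasDerivAt_id s).sub_const s
      have h4 : HasDerivAt (fun t : ℝ => F (p + s • v + t • v)) (FixedAngle.D v F (p + s • v))
          ((fun r : ℝ => r - s) s) := by simpa using h1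
      have h5 := HasDerivAt.comp (h := fun r : ℝ => r - s) s h4 h3
      refine (h5.congr_deriv (by simp)).congr_of_eventuallyEq (Eventually.of_forall fun r => ?_)
      simp only [Function.comp]
      congr 1
      rw [add_assoc, ← add_smul]; simp
    exact h2.deriv
  rw [hev.deriv_eq]
  exact HasDerivAt.deriv ((hF.D v).hasLineDerivAt hp v)

/-- Functions smooth up to the boundary of the half space which vanish far away. -/
structure Adm (F : X × ℝ → ℝ) : Prop where
  smooth : SmoothHalf F
  supp : ∃ R : ℝ, ∀ p ∈ halfSpace X, R < ‖p‖ → F p = 0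

theorem Adm.D {F : X × ℝ → ℝ} (hF : Adm F) (v : X × ℝ) : Adm (FixedAngle.D v F) := by
  obtain ⟨R, hR⟩ := hF.supp
  refine ⟨hF.smooth.D v, R, fun p hp hpR => ?_⟩
  exact D_eq_zero_on (O := {p | R < ‖p‖}) (isOpen_lt continuous_const continuous_norm) v
    (fun q hq hqH => hR q hqH hq) p hpR hp

theorem SmoothHalf.mul {F G : X × ℝ → ℝ} (hF : SmoothHalf F) (hG : SmoothHalf G) :
    SmoothHalf (fun p => F p * G p) := ContDiffOn.mul hF hG

theorem SmoothHalf.add {F G : X × ℝ → ℝ} (hF : SmoothHalf F) (hG : SmoothHalf G) :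
    SmoothHalf (fun p => F p + G p) := ContDiffOn.add hF hG

theorem SmoothHalf.sub {F G : X × ℝ → ℝ} (hF : SmoothHalf F) (hG : SmoothHalf G) :
    SmoothHalf (fun p => F p - G p) := ContDiffOn.sub hF hG

theorem SmoothHalf.const_mul {F : X × ℝ → ℝ} (c : ℝ) (hF : SmoothHalf F) :
    SmoothHalf (fun p => c * F p) := ContDiffOn.mul contDiffOn_const hF

theorem SmoothHalf.sum {ι : Type*} {s : Finset ι} {F : ι → X × ℝ → ℝ}
    (hF : ∀ i, SmoothHalf (F i)) : SmoothHalf (fun p => ∑ i ∈ s, F i p) :=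
  ContDiffOn.sum fun i _ => hF i

theorem Adm.mul_left {F G : X × ℝ → ℝ} (hF : SmoothHalf F) (hG : Adm G) :
    Adm (fun p => F p * G p) := by
  obtain ⟨R, hR⟩ := hG.supp
  exact ⟨hF.mul hG.smooth, R, fun p hp h => by simp [hR p hp h]⟩

theorem Adm.mul {F G : X × ℝ → ℝ} (hF : Adm F) (hG : Adm G) :
    Adm (fun p => F p * G p) := Adm.mul_left hF.smooth hG

theorem Adm.const_mul {G : X × ℝ → ℝ} (c : ℝ) (hG : Adm G) :
    Adm (fun p => c * G p) := by
  obtain ⟨R, hR⟩ := hG.supp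
  exact ⟨hG.smooth.const_mul c, R, fun p hp h => by simp [hR p hp h]⟩

theorem Adm.add {F G : X × ℝ → ℝ} (hF : Adm F) (hG : Adm G) :
    Adm (fun p => F p + G p) := by
  obtain ⟨R, hR⟩ := hF.supp
  obtain ⟨S, hS⟩ := hG.supp
  refine ⟨hF.smooth.add hG.smooth, max R S, fun p hp h => ?_⟩
  simp [hR p hp ((le_max_left _ _).trans_lt h), hS p hp ((le_max_right _ _).trans_lt h)]

theorem Adm.sub {F G : X × ℝ → ℝ} (hF : Adm F) (hG : Adm G) :
    Adm (fun p => F p - G p) := by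
  obtain ⟨R, hR⟩ := hF.supp
  obtain ⟨S, hS⟩ := hG.supp
  refine ⟨hF.smooth.sub hG.smooth, max R S, fun p hp h => ?_⟩
  simp [hR p hp ((le_max_left _ _).trans_lt h), hS p hp ((le_max_right _ _).trans_lt h)]

theorem Adm.sum {ι : Type*} {s : Finset ι} {F : ι → X × ℝ → ℝ} (hF : ∀ i, Adm (F i)) :
    Adm (fun p => ∑ i ∈ s, F i p) := by
  choose R hR using fun i => (hF i).supp
  refine ⟨SmoothHalf.sum fun i => (hF i).smooth, ∑ i ∈ s, |R i|, fun p hp h => ?_⟩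
  refine Finset.sum_eq_zero fun i hi => hR i p hp (lt_of_le_of_lt ?_ h)
  exact (le_abs_self _).trans (Finset.single_le_sum (f := fun i => |R i|)
    (fun j _ => abs_nonneg _) hi)

theorem Adm.sq {F : X × ℝ → ℝ} (hF : Adm F) : Adm (fun p => F p ^ 2) := by
  simpa only [pow_two] using hF.mul hF

theorem openHalf_eq_prod : openHalf X = univ ×ˢ Ioi (0 : ℝ) := by
  ext p; simp [openHalf]

theorem SmoothHalf.slice_contDiff {F : X × ℝ → ℝ} (hF : SmoothHalf F) {s : ℝ} (hs : 0 ≤ s) :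
    ContDiff ℝ ∞ (fun x : X => F (x, s)) := by
  rw [← contDiffOn_univ]
  exact ContDiffOn.comp (t := halfSpace X) hF (by fun_prop) (fun x _ => hs)

theorem SmoothHalf.hasDerivAt_vertical {F : X × ℝ → ℝ} (hF : SmoothHalf F) {x : X} {s : ℝ}
    (hs : 0 < s) :
    HasDerivAt (fun r : ℝ => F (x, r)) (FixedAngle.D (0, 1) F (x, s)) s := by
  have h := ((hF.differentiableOn (x, s) (openHalf_subset hs)).hasFDerivWithinAt).hasFDerivAt
    (halfSpace_mem_nhds hs)
  have h2 : HasDerivAt (fun r : ℝ => ((x, r) : X × ℝ)) (0, 1) s :=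
    (hasDerivAt_const s x).prodMk (hasDerivAt_id s)
  exact h.comp_hasDerivAt s h2

theorem SmoothHalf.continuousOn_vertical {F : X × ℝ → ℝ} (hF : SmoothHalf F) (x : X) :
    ContinuousOn (fun r : ℝ => F (x, r)) (Ici 0) :=
  hF.continuousOn.comp (by fun_prop) (fun _ hr => hr)

theorem Adm.vertical_eq_zero {F : X × ℝ → ℝ} (hF : Adm F) :
    ∃ R : ℝ, 0 ≤ R ∧ ∀ x : X, ∀ s : ℝ, R < s → F (x, s) = 0 := by
  obtain ⟨R, hR⟩ := hF.supp
  refine ⟨max R 0, le_max_right _ _, fun x s hs => hR (x, s) ((le_max_right R 0).trans hs.le) ?_⟩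
  calc R ≤ max R 0 := le_max_left _ _
    _ < s := hs
    _ ≤ ‖s‖ := le_abs_self s
    _ ≤ ‖(x, s)‖ := norm_snd_le (x, s)

variable [MeasureSpace X] [BorelSpace X] [FiniteDimensional ℝ X]
  [(volume : Measure X).IsAddHaarMeasure]

theorem Adm.integrableOn_closed {F : X × ℝ → ℝ} (hF : Adm F) : IntegrableOn F (halfSpace X) := by
  obtain ⟨R, hR⟩ := hF.supp
  have hc : IsCompact (halfSpace X ∩ Metric.closedBall 0 R) :=
    (isCompact_closedBall 0 R).inter_left isClosed_halfSpace
  have h1 : IntegrableOn F (halfSpace X ∩ Metric.closedBall 0 R) :=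
    (hF.smooth.continuousOn.mono inter_subset_left).integrableOn_compact hc
  refine h1.of_forall_sdiff_eq_zero isClosed_halfSpace.measurableSet fun p hp => ?_
  refine hR p hp.1 ?_
  by_contra hcon
  exact hp.2 ⟨hp.1, by simpa using not_lt.mp hcon⟩

theorem Adm.integrableOn {F : X × ℝ → ℝ} (hF : Adm F) : IntegrableOn F (openHalf X) :=
  hF.integrableOn_closed.mono_set openHalf_subset

theorem restrict_openHalf : (volume : Measure (X × ℝ)).restrict (openHalf X) =
    (volume : Measure X).prod ((volume : Measure ℝ).restrict (Ioi 0)) := by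
  rw [openHalf_eq_prod, Measure.volume_eq_prod, ← Measure.prod_restrict, Measure.restrict_univ]

theorem Adm.slice_hasCompactSupport {F : X × ℝ → ℝ} (hF : Adm F) {s : ℝ} (hs : 0 ≤ s) :
    HasCompactSupport (fun x : X => F (x, s)) := by
  obtain ⟨R, hR⟩ := hF.supp
  refine HasCompactSupport.intro (isCompact_closedBall (0 : X) R) fun x hx => ?_
  refine hR _ hs (lt_of_lt_of_le ?_ (norm_fst_le (x, s)))
  simpa using hx

theorem integral_fderiv_eq_zero {f : X → ℝ} (hf : ContDiff ℝ ∞ f) (hc : HasCompactSupport f)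
    (v : X) : ∫ x, fderiv ℝ f x v = 0 := by
  obtain ⟨C, hC⟩ := hf.lipschitzWith_of_hasCompactSupport hc (by simp)
  have h := (LipschitzWith.const (1 : ℝ)).integral_lineDeriv_mul_eq (E := X) (μ := volume) hC hc (-v)
  simp only [lineDeriv, deriv_const, zero_mul, integral_zero, neg_neg, mul_one] at h
  change 0 = ∫ x, lineDeriv ℝ f x v at h
  rw [h]
  refine integral_congr_ae (Eventually.of_forall fun x => ?_)
  exact ((hf.differentiable (by simp) x).lineDeriv_eq_fderiv).symm

theorem Adm.integral_D_horizontal {F : X × ℝ → ℝ} (hF : Adm F) (v : X) :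
    ∫ p in openHalf X, FixedAngle.D (v, 0) F p = 0 := by
  have hi := (hF.D (v, 0)).integrableOn
  rw [IntegrableOn, restrict_openHalf] at hi
  rw [restrict_openHalf, integral_prod_symm _ hi]
  refine setIntegral_eq_zero_of_forall_eq_zero fun s hs => ?_
  have hs' : 0 < s := hs
  have hsl := SmoothHalf.slice_contDiff hF.smooth hs'.le
  refine Eq.trans ?_ (integral_fderiv_eq_zero hsl (hF.slice_hasCompactSupport hs'.le) v)
  refine integral_congr_ae (Eventually.of_forall fun x => ?_)
  refine hF.smooth.D_eq_horizontal (p := (x, s)) hs'.le ?_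
  have := (hsl.differentiable (by simp) x).hasFDerivAt.hasLineDerivAt v
  unfold HasLineDerivAt at this ⊢
  simpa using this

theorem Adm.integral_vertical {F : X × ℝ → ℝ} (hF : Adm F) (x : X) :
    ∫ s in Ioi (0 : ℝ), FixedAngle.D (0, 1) F (x, s) = -F (x, 0) := by
  obtain ⟨R, hR0, hR⟩ := hF.vertical_eq_zero
  obtain ⟨S, hS0, hS⟩ := (hF.D (0, 1)).vertical_eq_zero
  have hInt : IntegrableOn (fun s => FixedAngle.D (0, 1) F (x, s)) (Ioi 0) := by
    have h1 : IntegrableOn (fun s => FixedAngle.D (0, 1) F (x, s)) (Icc 0 S) :=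
      ((SmoothHalf.continuousOn_vertical (hF.smooth.D (0, 1)) x).mono Icc_subset_Ici_self).integrableOn_compact
        isCompact_Icc
    have h2 : IntegrableOn (fun s => FixedAngle.D (0, 1) F (x, s)) (Ici 0) := by
      refine h1.of_forall_sdiff_eq_zero measurableSet_Ici fun s hs => hS x s ?_
      by_contra hcon
      exact hs.2 ⟨hs.1, not_lt.mp hcon⟩
    exact h2.mono_set Ioi_subset_Ici_self
  have := integral_Ioi_of_hasDerivAt_of_tendsto
    ((SmoothHalf.continuousOn_vertical hF.smooth x) 0 self_mem_Ici)
    (fun s hs => SmoothHalf.hasDerivAt_vertical hF.smooth hs) hInt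
    (m := 0) (tendsto_const_nhds.congr' (by
      filter_upwards [eventually_gt_atTop R] with s hs
      exact (hR x s hs).symm))
  rw [this, zero_sub]

theorem Adm.integral_D_vertical {F : X × ℝ → ℝ} (hF : Adm F) :
    ∫ p in openHalf X, FixedAngle.D (0, 1) F p = -∫ x, F (x, 0) := by
  have hi := (hF.D (0, 1)).integrableOn
  rw [IntegrableOn, restrict_openHalf] at hi
  rw [restrict_openHalf, integral_prod _ hi, ← integral_neg]
  exact integral_congr_ae (Eventually.of_forall fun x => hF.integral_vertical x)

theorem Adm.integrable_trace {F : X × ℝ → ℝ} (hF : Adm F) : Integrable (fun x => F (x, 0)) :=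
  (SmoothHalf.slice_contDiff hF.smooth le_rfl).continuous.integrable_of_hasCompactSupport
    (hF.slice_hasCompactSupport le_rfl)

end HalfSpace

section LineDerivative

variable {E : Type*} [AddCommGroup E] [Module ℝ E] {f g : E → ℝ} {f' g' : ℝ} {p v : E}

theorem lineDeriv_mul (hf : HasLineDerivAt ℝ f f' p v) (hg : HasLineDerivAt ℝ g g' p v) :
    HasLineDerivAt ℝ (fun q => f q * g q) (f' * g p + f p * g') p v := by
  unfold HasLineDerivAt at *
  simpa using HasDerivAt.fun_mul hf hg

theorem lineDeriv_add (hf : HasLineDerivAt ℝ f f' p v) (hg : HasLineDerivAt ℝ g g' p v) :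
    HasLineDerivAt ℝ (fun q => f q + g q) (f' + g') p v := HasDerivAt.fun_add hf hg

theorem lineDeriv_sub (hf : HasLineDerivAt ℝ f f' p v) (hg : HasLineDerivAt ℝ g g' p v) :
    HasLineDerivAt ℝ (fun q => f q - g q) (f' - g') p v := HasDerivAt.fun_sub hf hg

theorem lineDeriv_const_mul (c : ℝ) (hf : HasLineDerivAt ℝ f f' p v) :
    HasLineDerivAt ℝ (fun q => c * f q) (c * f') p v := HasDerivAt.const_mul c hf

theorem lineDeriv_sq (hf : HasLineDerivAt ℝ f f' p v) :
    HasLineDerivAt ℝ (fun q => f q ^ 2) (2 * f p * f') p v := by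
  have := lineDeriv_mul hf hf
  simp only [← pow_two] at this
  convert this using 1
  ring

theorem lineDeriv_sum {ι : Type*} {s : Finset ι} {f : ι → E → ℝ} {f' : ι → ℝ}
    (hf : ∀ i, HasLineDerivAt ℝ (f i) (f' i) p v) :
    HasLineDerivAt ℝ (fun q => ∑ i ∈ s, f i q) (∑ i ∈ s, f' i) p v := by
  unfold HasLineDerivAt at *
  exact HasDerivAt.fun_sum fun i _ => hf i

theorem lineDeriv_comp {h : ℝ → ℝ} {h' : ℝ} (hh : HasDerivAt h h' (f p))
    (hf : HasLineDerivAt ℝ f f' p v) : HasLineDerivAt ℝ (fun q => h (f q)) (h' * f') p v := by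
  unfold HasLineDerivAt at *
  have : HasDerivAt h h' (f (p + (0 : ℝ) • v)) := by simpa using hh
  exact HasDerivAt.comp (0 : ℝ) this hf

end LineDerivative

variable {m : ℕ}

/-- Points `x = (y, z)` of space. -/
abbrev Sp (m : ℕ) := EuclideanSpace ℝ (Fin m) × ℝ

/-- Points `((y, z), s)`, where `s = t - z` is the time elapsed since the incoming front. -/
abbrev SpT (m : ℕ) := Sp m × ℝ

noncomputable abbrev ey (i : Fin m) : SpT m := ((EuclideanSpace.single i 1, 0), 0)

abbrev ez : SpT m := ((0, 1), 0)

abbrev es : SpT m := (0, 1)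

instance : (volume : Measure (Sp m)).IsAddHaarMeasure :=
  inferInstanceAs (((volume : Measure (EuclideanSpace ℝ (Fin m))).prod
    (volume : Measure ℝ)).IsAddHaarMeasure)

/-- The squared Euclidean norm of `x`. -/
noncomputable def normSq (x : Sp m) : ℝ := ‖x.1‖ ^ 2 + x.2 ^ 2

/-- The operator `Δ - ∂ₜ²` in the coordinates `((y, z), s)`. -/
noncomputable def Lop (U : SpT m → ℝ) (p : SpT m) : ℝ :=
  (∑ i, D (ey i) (D (ey i) U) p) + D ez (D ez U) p - 2 * D ez (D es U) p

theorem normSq_eq_sum (x : Sp m) : normSq x = ∑ i, x.1 i ^ 2 + x.2 ^ 2 := by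
  rw [normSq, EuclideanSpace.real_norm_sq_eq]

theorem contDiff_normSq : ContDiff ℝ ∞ (normSq : Sp m → ℝ) := by
  unfold normSq
  exact ((contDiff_norm_sq ℝ).comp contDiff_fst).add (contDiff_snd.pow 2)

theorem normSq_nonneg (x : Sp m) : 0 ≤ normSq x := by unfold normSq; positivity

theorem contDiff_coord (j : Fin m) : ContDiff ℝ ∞ (fun p : SpT m => p.1.1 j) := by
  have : ContDiff ℝ ∞ (fun y : EuclideanSpace ℝ (Fin m) => y j) :=
    (EuclideanSpace.proj j : EuclideanSpace ℝ (Fin m) →L[ℝ] ℝ).contDiff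
  exact this.comp (contDiff_fst.comp contDiff_fst)

theorem lineDeriv_coord (j : Fin m) (p v : SpT m) :
    HasLineDerivAt ℝ (fun q : SpT m => q.1.1 j) (v.1.1 j) p v := by
  unfold HasLineDerivAt
  simpa using ((hasDerivAt_id (0 : ℝ)).mul_const (v.1.1 j)).const_add (p.1.1 j)

theorem lineDeriv_z (p v : SpT m) : HasLineDerivAt ℝ (fun q : SpT m => q.1.2) v.1.2 p v := by
  unfold HasLineDerivAt
  simpa using ((hasDerivAt_id (0 : ℝ)).mul_const v.1.2).const_add p.1.2

theorem lineDeriv_s (p v : SpT m) : HasLineDerivAt ℝ (fun q : SpT m => q.2) v.2 p v := by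
  unfold HasLineDerivAt
  simpa using ((hasDerivAt_id (0 : ℝ)).mul_const v.2).const_add p.2

theorem lineDeriv_normSq (p v : SpT m) :
    HasLineDerivAt ℝ (fun q : SpT m => normSq q.1)
      (∑ j, 2 * p.1.1 j * v.1.1 j + 2 * p.1.2 * v.1.2) p v := by
  simp only [normSq_eq_sum]
  exact lineDeriv_add (lineDeriv_sum fun j => lineDeriv_sq (lineDeriv_coord j p v))
    (lineDeriv_sq (lineDeriv_z p v))

theorem volume_sphere : volume {x : Sp m | normSq x = 1} = 0 := by
  have hm : MeasurableSet {x : Sp m | normSq x = 1} :=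
    (isClosed_eq contDiff_normSq.continuous continuous_const).measurableSet
  rw [Measure.volume_eq_prod, Measure.measure_prod_null hm]
  refine Eventually.of_forall fun y => ?_
  refine (Set.Finite.subset (s := {√(1 - ‖y‖ ^ 2), -√(1 - ‖y‖ ^ 2)}) (by simp) ?_).measure_zero _
  intro z hz
  have hz' : ‖y‖ ^ 2 + z ^ 2 = 1 := hz
  have : √(1 - ‖y‖ ^ 2) = |z| := by rw [← hz', add_sub_cancel_left, Real.sqrt_sq_eq_abs]
  rw [this]
  rcases abs_cases z with h | h <;> simp [h.1]

theorem integral_fderiv_exterior {f : Sp m → ℝ} (hf : ContDiff ℝ ∞ f) (hc : HasCompactSupport f)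
    (hS : ∀ x, normSq x = 1 → f x = 0) (v : Sp m) :
    ∫ x in {x | 1 < normSq x}, fderiv ℝ f x v = 0 := by
  classical
  obtain ⟨C, hC⟩ := hf.lipschitzWith_of_hasCompactSupport hc (by simp)
  set A : Set (Sp m) := {x | 1 < normSq x} with hA
  have hcn : Continuous (normSq : Sp m → ℝ) := contDiff_normSq.continuous
  have hAo : IsOpen A := isOpen_lt continuous_const hcn
  have key : ∀ x y : Sp m, x ∈ A → y ∉ A → |f x| ≤ C * dist x y := by
    intro x y hx hy
    have hy' : normSq y ≤ 1 := not_lt.mp hy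
    have hcont : ContinuousOn (fun t : ℝ => normSq (y + t • (x - y))) (Icc 0 1) := by
      have : Continuous (fun t : ℝ => y + t • (x - y)) := by fun_prop
      exact (hcn.comp this).continuousOn
    have hmem : (1 : ℝ) ∈ Icc (normSq (y + (0 : ℝ) • (x - y))) (normSq (y + (1 : ℝ) • (x - y))) := by
      simp only [zero_smul, add_zero, one_smul, add_sub_cancel]
      exact ⟨hy', le_of_lt hx⟩
    obtain ⟨t, ht, ht1⟩ := intermediate_value_Icc (zero_le_one' ℝ) hcont hmem
    have h0 := hS _ ht1
    have h1 := hC.dist_le_mul x (y + t • (x - y))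
    rw [h0, Real.dist_eq, sub_zero] at h1
    refine h1.trans (mul_le_mul_of_nonneg_left ?_ C.2)
    have : x - (y + t • (x - y)) = (1 - t) • (x - y) := by
      rw [sub_smul, one_smul]; abel
    rw [dist_eq_norm, this, norm_smul, dist_eq_norm]
    have h2 : ‖1 - t‖ ≤ 1 := by
      rw [Real.norm_eq_abs, abs_le]; constructor <;> linarith [ht.1, ht.2]
    exact mul_le_of_le_one_left (norm_nonneg _) h2
  have hG : LipschitzWith C (A.indicator f) := by
    refine LipschitzWith.of_dist_le_mul fun x y => ?_
    by_cases hx : x ∈ A <;> by_cases hy : y ∈ A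
    · simpa [hx, hy] using hC.dist_le_mul x y
    · simpa [hx, hy] using key x y hx hy
    · rw [dist_comm, dist_comm x y]
      simpa [hx, hy] using key y x hy hx
    · simp only [hx, hy, not_false_eq_true, indicator_of_notMem, dist_self]; positivity
  have hGc : HasCompactSupport (A.indicator f) := by
    refine hc.mono fun x hx => ?_
    simp only [Function.mem_support, ne_eq, indicator_apply_eq_zero, not_forall] at hx ⊢
    exact hx.2
  have h := (LipschitzWith.const (1 : ℝ)).integral_lineDeriv_mul_eq (E := Sp m) (μ := volume) hG hGc (-v)
  have h0 : ∀ x w : Sp m, lineDeriv ℝ (fun _ : Sp m => (1 : ℝ)) x w = 0 := by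
    intro x w; simp [lineDeriv]
  simp only [h0, zero_mul, integral_zero, neg_neg, mul_one] at h
  rw [h, ← integral_indicator hAo.measurableSet]
  refine integral_congr_ae ?_
  have hne : ∀ᵐ x : Sp m, normSq x ≠ 1 := by
    rw [ae_iff]; simpa using volume_sphere
  filter_upwards [hne] with x hx
  rcases lt_or_gt_of_ne hx with hx | hx
  · have hev : A.indicator f =ᶠ[𝓝 x] fun _ => 0 := by
      filter_upwards [(isOpen_lt hcn continuous_const).mem_nhds hx] with y hy
      exact indicator_of_notMem (s := A) (fun h => lt_asymm h hy) f
    rw [indicator_of_notMem (s := A) (fun h => lt_asymm h hx), hev.lineDeriv_eq]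
    simp [lineDeriv]
  · have hev : A.indicator f =ᶠ[𝓝 x] f := by
      filter_upwards [hAo.mem_nhds hx] with y hy
      exact indicator_of_mem hy f
    rw [indicator_of_mem (show x ∈ A from hx), hev.lineDeriv_eq]
    exact ((hf.differentiable (by simp) x).lineDeriv_eq_fderiv).symm

/-- The part of the open half space lying over the exterior of the unit ball. -/
def extHalf (m : ℕ) : Set (SpT m) := {p | 0 < p.2 ∧ 1 < normSq p.1}

theorem isOpen_extHalf : IsOpen (extHalf m) :=
  (isOpen_lt continuous_const continuous_snd).inter
    (isOpen_lt continuous_const (contDiff_normSq.continuous.comp continuous_fst))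

theorem restrict_extHalf : (volume : Measure (SpT m)).restrict (extHalf m) =
    ((volume : Measure (Sp m)).restrict {x | 1 < normSq x}).prod
      ((volume : Measure ℝ).restrict (Ioi 0)) := by
  have : extHalf m = {x : Sp m | 1 < normSq x} ×ˢ Ioi (0 : ℝ) := by
    ext p; simp [extHalf, and_comm]
  rw [this, Measure.volume_eq_prod, ← Measure.prod_restrict]

theorem Adm.integrableOn_ext {F : SpT m → ℝ} (hF : Adm F) : IntegrableOn F (extHalf m) :=
  hF.integrableOn.mono_set fun _ h => h.1

theorem Adm.integral_ext_horizontal {F : SpT m → ℝ} (hF : Adm F)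
    (hS : ∀ p : SpT m, 0 < p.2 → normSq p.1 = 1 → F p = 0) (v : Sp m) :
    ∫ p in extHalf m, FixedAngle.D (v, 0) F p = 0 := by
  have hi := (hF.D (v, 0)).integrableOn_ext
  rw [IntegrableOn, restrict_extHalf] at hi
  rw [restrict_extHalf, integral_prod_symm _ hi]
  refine setIntegral_eq_zero_of_forall_eq_zero fun s hs => ?_
  have hs' : 0 < s := hs
  have hsl := SmoothHalf.slice_contDiff hF.smooth hs'.le
  refine Eq.trans ?_ (integral_fderiv_exterior hsl (hF.slice_hasCompactSupport hs'.le)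
    (fun x hx => hS (x, s) hs hx) v)
  refine integral_congr_ae (Eventually.of_forall fun x => ?_)
  refine hF.smooth.D_eq_horizontal (p := (x, s)) hs'.le ?_
  have := (hsl.differentiable (by simp) x).hasFDerivAt.hasLineDerivAt v
  unfold HasLineDerivAt at this ⊢
  simpa using this

theorem Adm.integral_ext_vertical {F : SpT m → ℝ} (hF : Adm F)
    (h0 : ∀ x : Sp m, 1 < normSq x → F (x, 0) = 0) :
    ∫ p in extHalf m, FixedAngle.D (0, 1) F p = 0 := by
  have hi := (hF.D (0, 1)).integrableOn_ext
  rw [IntegrableOn, restrict_extHalf] at hi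
  rw [restrict_extHalf, integral_prod _ hi]
  refine setIntegral_eq_zero_of_forall_eq_zero fun x hx => ?_
  rw [hF.integral_vertical x, h0 x hx, neg_zero]

theorem hasDerivAt_expNegInvGlue (r : ℝ) :
    HasDerivAt expNegInvGlue (r⁻¹ ^ 2 * expNegInvGlue r) r := by
  simpa using expNegInvGlue.hasDerivAt_polynomial_eval_inv_mul 1 r

/-- The height below the space-like surface `t + ε |x|² = T`, in the coordinates `((y, z), s)`. -/
noncomputable def depth (T ε : ℝ) (p : SpT m) : ℝ := T - (p.1.2 + p.2 + ε * normSq p.1)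

theorem contDiff_depth (T ε : ℝ) : ContDiff ℝ ∞ (depth T ε : SpT m → ℝ) := by
  unfold depth
  have h := (contDiff_normSq (m := m)).comp (contDiff_fst (E := Sp m) (F := ℝ))
  exact contDiff_const.sub (((contDiff_snd.comp contDiff_fst).add contDiff_snd).add
    (contDiff_const.mul h))

theorem lineDeriv_depth (T ε : ℝ) (p v : SpT m) :
    HasLineDerivAt ℝ (depth T ε)
      (-(v.1.2 + v.2 + ε * (∑ j, 2 * p.1.1 j * v.1.1 j + 2 * p.1.2 * v.1.2))) p v := by
  have hc : HasLineDerivAt ℝ (fun _ : SpT m => T) 0 p v := hasDerivAt_const _ _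
  have := lineDeriv_sub hc (lineDeriv_add (lineDeriv_add (lineDeriv_z p v) (lineDeriv_s p v))
    (lineDeriv_const_mul ε (lineDeriv_normSq p v)))
  rw [zero_sub] at this
  exact this

theorem sum_mul_single (y : EuclideanSpace ℝ (Fin m)) (i : Fin m) :
    ∑ j, 2 * y j * (EuclideanSpace.single i (1 : ℝ) : EuclideanSpace ℝ (Fin m)) j = 2 * y i := by
  simp [PiLp.single_apply]

/-- The energy identity for the multiplier `∂ₛU` with weight `expNegInvGlue (depth T ε)`. -/
theorem energy_identity {U : SpT m → ℝ} (hU : SmoothHalf U) (T ε : ℝ) {p : SpT m} (hp : 0 < p.2)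
    (hL : Lop U p = 0) :
    2 * ∑ i, D (ey i)
        (fun q => expNegInvGlue (depth T ε q) * (D (ey i) U q * D es U q)) p
      - 2 * D ez (fun q => expNegInvGlue (depth T ε q) *
          (D es U q ^ 2 - D ez U q * D es U q)) p
      - D es (fun q => expNegInvGlue (depth T ε q) * (∑ i, D (ey i) U q ^ 2 + D ez U q ^ 2)) p
    = (depth T ε p)⁻¹ ^ 2 * expNegInvGlue (depth T ε p) *
      (∑ i, (D (ey i) U p - 2 * ε * p.1.1 i * D es U p) ^ 2
        + (D ez U p - (2 * ε * p.1.2 + 1) * D es U p) ^ 2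
        + D es U p ^ 2 * (1 - 4 * ε ^ 2 * normSq p.1)) := by
  have hw : SmoothHalf (fun q : SpT m => expNegInvGlue (depth T ε q)) :=
    SmoothHalf.of_contDiff (expNegInvGlue.contDiff.comp (contDiff_depth T ε))
  have hwd : ∀ v : SpT m, HasLineDerivAt ℝ (fun q => expNegInvGlue (depth T ε q)) _ p v :=
    fun v => lineDeriv_comp (hasDerivAt_expNegInvGlue (depth T ε p)) (lineDeriv_depth T ε p v)
  have hd : ∀ v w : SpT m, HasLineDerivAt ℝ (D w U) (D v (D w U) p) p v :=
    fun v w => (hU.D w).hasLineDerivAt hp v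
  set w := expNegInvGlue (depth T ε p) with hwdef
  set k := (depth T ε p)⁻¹ ^ 2 * w with hk
  have h1 : ∀ i, D (ey i)
        (fun q => expNegInvGlue (depth T ε q) * (D (ey i) U q * D es U q)) p =
      k * (-2 * ε * p.1.1 i) * (D (ey i) U p * D es U p) +
        w * (D (ey i) (D (ey i) U) p * D es U p + D (ey i) U p * D (ey i) (D es U) p) := by
    intro i
    rw [SmoothHalf.D_eq (hw.mul ((hU.D _).mul (hU.D _))) hp
      (lineDeriv_mul (hwd (ey i)) (lineDeriv_mul (hd (ey i) (ey i)) (hd (ey i) es)))]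
    simp only [ey, sum_mul_single]
    ring
  have h2 : D ez (fun q => expNegInvGlue (depth T ε q) *
          (D es U q ^ 2 - D ez U q * D es U q)) p =
      k * (-(1 + 2 * ε * p.1.2)) * (D es U p ^ 2 - D ez U p * D es U p) +
        w * (2 * D es U p * D ez (D es U) p -
          (D ez (D ez U) p * D es U p + D ez U p * D ez (D es U) p)) := by
    have hs : SmoothHalf (fun q => D es U q ^ 2) := by
      simpa only [pow_two] using (hU.D es).mul (hU.D es)
    rw [SmoothHalf.D_eq (hw.mul (hs.sub ((hU.D _).mul (hU.D _)))) hp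
      (lineDeriv_mul (hwd ez) (lineDeriv_sub (lineDeriv_sq (hd ez es))
        (lineDeriv_mul (hd ez ez) (hd ez es))))]
    simp
    ring
  have h3 : D es (fun q => expNegInvGlue (depth T ε q) *
        (∑ i, D (ey i) U q ^ 2 + D ez U q ^ 2)) p =
      k * (-1) * (∑ i, D (ey i) U p ^ 2 + D ez U p ^ 2) +
        w * (∑ i, 2 * D (ey i) U p * D (ey i) (D es U) p + 2 * D ez U p * D ez (D es U) p) := by
    have hs : ∀ v, SmoothHalf (fun q => D v U q ^ 2) := fun v => by
      simpa only [pow_two] using (hU.D v).mul (hU.D v)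
    rw [SmoothHalf.D_eq (hw.mul ((SmoothHalf.sum fun i => hs (ey i)).add (hs ez))) hp
      (lineDeriv_mul (hwd es) (lineDeriv_add (lineDeriv_sum fun i => lineDeriv_sq (hd es (ey i)))
        (lineDeriv_sq (hd es ez))))]
    simp only [hU.D_comm hp es]
    simp [hk, hwdef]
  have hLap : ∑ i, D (ey i) (D (ey i) U) p = 2 * D ez (D es U) p - D ez (D ez U) p := by
    unfold Lop at hL; linarith
  have e1 : ∑ i, D (ey i)
        (fun q => expNegInvGlue (depth T ε q) * (D (ey i) U q * D es U q)) p =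
      -2 * ε * k * D es U p * (∑ i, p.1.1 i * D (ey i) U p)
        + w * D es U p * (∑ i, D (ey i) (D (ey i) U) p)
        + w * ∑ i, D (ey i) U p * D (ey i) (D es U) p := by
    simp only [h1, Finset.mul_sum, ← Finset.sum_add_distrib]
    exact Finset.sum_congr rfl fun i _ => by ring
  have e2 : ∑ i, (D (ey i) U p - 2 * ε * p.1.1 i * D es U p) ^ 2 =
      ∑ i, D (ey i) U p ^ 2 - 4 * ε * D es U p * (∑ i, p.1.1 i * D (ey i) U p)
        + 4 * ε ^ 2 * D es U p ^ 2 * ∑ i, p.1.1 i ^ 2 := by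
    simp only [Finset.mul_sum, ← Finset.sum_add_distrib, ← Finset.sum_sub_distrib]
    exact Finset.sum_congr rfl fun i _ => by ring
  have e3 : ∑ i, 2 * D (ey i) U p * D (ey i) (D es U) p =
      2 * ∑ i, D (ey i) U p * D (ey i) (D es U) p := by
    simp only [Finset.mul_sum]
    exact Finset.sum_congr rfl fun i _ => by ring
  rw [e1, h2, h3, e2, e3, hLap, normSq_eq_sum]
  ring

theorem adm_cutoff {T ε : ℝ} (hε : 0 < ε) {G : SpT m → ℝ} (hG : SmoothHalf G)
    (hearly : ∀ p ∈ halfSpace (Sp m), p.1.2 + p.2 < -1 → G p = 0) :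
    Adm (fun p => expNegInvGlue (depth T ε p) * G p) := by
  refine ⟨(SmoothHalf.of_contDiff (expNegInvGlue.contDiff.comp (contDiff_depth T ε))).mul hG,
    |T| + 2 + 2 * (|T| + 1) / ε + 1, fun p hp hR => ?_⟩
  by_cases h1 : p.1.2 + p.2 < -1
  · rw [hearly p hp h1, mul_zero]
  by_cases h2 : depth T ε p ≤ 0
  · rw [expNegInvGlue.zero_of_nonpos h2, zero_mul]
  exfalso
  have h1' := not_lt.mp h1
  have h2' := not_le.mp h2
  have hn0 := normSq_nonneg p.1
  have hT := le_abs_self T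
  have hp0 : 0 ≤ p.2 := hp
  unfold depth at h2'
  set ρ := (|T| + 1) / ε with hρ
  have hρ0 : 0 ≤ ρ := by positivity
  have hr : normSq p.1 ≤ ρ := by
    rw [hρ, le_div_iff₀ hε]; nlinarith
  have hy : ‖p.1.1‖ ≤ 1 + ρ := by
    unfold normSq at hr; nlinarith [sq_nonneg p.1.2, sq_nonneg (‖p.1.1‖ - 1)]
  have hz : |p.1.2| ≤ 1 + ρ := by
    unfold normSq at hr; nlinarith [sq_abs p.1.2, sq_nonneg ‖p.1.1‖, sq_nonneg (|p.1.2| - 1)]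
  have hs : |p.2| ≤ |T| + 1 + ρ + 1 := by
    rw [abs_of_nonneg hp0]
    have := neg_abs_le p.1.2
    nlinarith
  have : ‖p‖ ≤ |T| + 2 + 2 * (|T| + 1) / ε + 1 := by
    have e : 2 * (|T| + 1) / ε = 2 * ρ := by rw [hρ]; ring
    rw [e]
    refine norm_prod_le_iff.2 ⟨norm_prod_le_iff.2 ⟨?_, ?_⟩, ?_⟩
    · linarith [abs_nonneg T]
    · rw [Real.norm_eq_abs]; linarith [abs_nonneg T]
    · rw [Real.norm_eq_abs]; linarith
  linarith

theorem ds_eq_zero_exterior {T ε : ℝ} (hε : 0 < ε) (hεT : 4 * ε * (T + 1) < 1)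
    {U : SpT m → ℝ} (hU : SmoothHalf U)
    (hL : ∀ p : SpT m, 0 < p.2 → 1 < normSq p.1 → Lop U p = 0)
    (hinit : ∀ x : Sp m, 1 ≤ normSq x → U (x, 0) = 0)
    (hearly : ∀ p ∈ halfSpace (Sp m), p.1.2 + p.2 < -1 → U p = 0)
    (hsph : ∀ p ∈ halfSpace (Sp m), normSq p.1 = 1 → p.1.2 + p.2 ≤ T → U p = 0)
    {p : SpT m} (hp : p ∈ extHalf m) (hdepth : 0 < depth T ε p) : D es U p = 0 := by
  have hearlyD : ∀ v : SpT m, ∀ p ∈ halfSpace (Sp m), p.1.2 + p.2 < -1 → D v U p = 0 := by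
    intro v p hp h
    refine D_eq_zero_on (O := {p : SpT m | p.1.2 + p.2 < -1}) ?_ v
      (fun q hq hqH => hearly q hqH hq) p h hp
    exact isOpen_lt (by fun_prop) continuous_const
  have hsphD : ∀ p : SpT m, 0 < p.2 → normSq p.1 = 1 → 0 < depth T ε p → D es U p = 0 := by
    intro p hp h1 hd
    refine hU.D_eq hp ?_
    unfold HasLineDerivAt
    have hlt : p.1.2 + p.2 < T := by
      unfold depth at hd; nlinarith
    refine (hasDerivAt_const (0 : ℝ) (0 : ℝ)).congr_of_eventuallyEq ?_
    have hc1 : Tendsto (fun t : ℝ => p.2 + t) (𝓝 0) (𝓝 p.2) := by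
      have : Continuous fun t : ℝ => p.2 + t := by fun_prop
      simpa using this.tendsto 0
    filter_upwards [hc1 (Ioi_mem_nhds hp), hc1 (Iio_mem_nhds (show p.2 < T - p.1.2 by linarith))]
      with t ht1 ht2
    have ht1' : 0 < p.2 + t := ht1
    have ht2' : p.2 + t < T - p.1.2 := ht2
    refine hsph _ ?_ ?_ ?_
    · change 0 ≤ (p + t • es).2
      simpa using ht1'.le
    · simpa using h1
    · simp only [Prod.fst_add, Prod.smul_fst, smul_zero, add_zero, Prod.snd_add, Prod.smul_snd,
        smul_eq_mul, mul_one]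
      linarith
  have hF1 : ∀ i : Fin m, Adm (fun q => expNegInvGlue (depth T ε q) * (D (ey i) U q * D es U q)) :=
    fun i => adm_cutoff hε ((hU.D _).mul (hU.D _)) fun q hq h => by
      rw [hearlyD es q hq h, mul_zero]
  have hsq : ∀ v, SmoothHalf (fun q => D v U q ^ 2) := fun v => by
    simpa only [pow_two] using (hU.D v).mul (hU.D v)
  have hF2 : Adm (fun q => expNegInvGlue (depth T ε q) *
      (D es U q ^ 2 - D ez U q * D es U q)) :=
    adm_cutoff hε ((hsq _).sub ((hU.D _).mul (hU.D _))) fun q hq h => by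
      rw [hearlyD es q hq h]; ring
  have hF3 : Adm (fun q => expNegInvGlue (depth T ε q) *
      (∑ i, D (ey i) U q ^ 2 + D ez U q ^ 2)) :=
    adm_cutoff hε ((SmoothHalf.sum fun i => hsq _).add (hsq _)) fun q hq h => by
      simp [hearlyD _ q hq h]
  have hi1 : ∀ i : Fin m, ∫ p in extHalf m, D (ey i)
      (fun q => expNegInvGlue (depth T ε q) * (D (ey i) U q * D es U q)) p = 0 := fun i =>
    (hF1 i).integral_ext_horizontal (fun q hq hq1 => by
      by_cases hd : 0 < depth T ε q
      · rw [hsphD q hq hq1 hd]; ring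
      · rw [expNegInvGlue.zero_of_nonpos (not_lt.mp hd), zero_mul]) _
  have hi2 : ∫ p in extHalf m, D ez (fun q => expNegInvGlue (depth T ε q) *
      (D es U q ^ 2 - D ez U q * D es U q)) p = 0 :=
    hF2.integral_ext_horizontal (fun q hq hq1 => by
      by_cases hd : 0 < depth T ε q
      · rw [hsphD q hq hq1 hd]; ring
      · rw [expNegInvGlue.zero_of_nonpos (not_lt.mp hd), zero_mul]) _
  have hflat : ∀ x : Sp m, 1 < normSq x → ∀ v : Sp m, D (v, 0) U (x, 0) = 0 := by
    intro x hx v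
    refine hU.D_eq_horizontal (p := (x, 0)) le_rfl ?_
    unfold HasLineDerivAt
    refine (hasDerivAt_const (0 : ℝ) (0 : ℝ)).congr_of_eventuallyEq ?_
    have hc : Tendsto (fun t : ℝ => normSq (x + t • v)) (𝓝 0) (𝓝 (normSq x)) := by
      have h1 : Continuous fun t : ℝ => x + t • v := by fun_prop
      have h2 : Continuous fun t : ℝ => normSq (x + t • v) := contDiff_normSq.continuous.comp h1
      simpa using h2.tendsto 0
    filter_upwards [hc (Ioi_mem_nhds hx)] with t ht
    have ht' : 1 < normSq (x + t • v) := ht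
    simpa using hinit _ ht'.le
  have hi3 : ∫ p in extHalf m, D es (fun q => expNegInvGlue (depth T ε q) *
      (∑ i, D (ey i) U q ^ 2 + D ez U q ^ 2)) p = 0 :=
    hF3.integral_ext_vertical fun x hx => by
      simp [hflat x hx]
  set e : SpT m → ℝ := fun p => 2 * ∑ i, D (ey i)
        (fun q => expNegInvGlue (depth T ε q) * (D (ey i) U q * D es U q)) p
      - 2 * D ez (fun q => expNegInvGlue (depth T ε q) *
          (D es U q ^ 2 - D ez U q * D es U q)) p
      - D es (fun q => expNegInvGlue (depth T ε q) * (∑ i, D (ey i) U q ^ 2 + D ez U q ^ 2)) p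
    with he
  have hAdm : Adm e :=
    (((Adm.sum fun i => (hF1 i).D _).const_mul 2).sub ((hF2.D _).const_mul 2)).sub (hF3.D _)
  have hzero : ∫ p in extHalf m, e p = 0 := by
    rw [he]
    rw [integral_sub (((Adm.sum fun i => (hF1 i).D _).const_mul 2).sub
        ((hF2.D _).const_mul 2)).integrableOn_ext (hF3.D _).integrableOn_ext,
      integral_sub ((Adm.sum fun i => (hF1 i).D _).const_mul 2).integrableOn_ext
        ((hF2.D _).const_mul 2).integrableOn_ext, integral_const_mul, integral_const_mul,
      integral_finsetSum _ fun i _ => ((hF1 i).D _).integrableOn_ext, hi2, hi3]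
    simp [hi1]
  have hfac : ∀ q ∈ extHalf m, 0 < depth T ε q → ¬ q.1.2 + q.2 < -1 →
      0 < 1 - 4 * ε ^ 2 * normSq q.1 := by
    intro q _ hd h1
    unfold depth at hd
    nlinarith [not_lt.mp h1, normSq_nonneg q.1]
  have hnn : ∀ q ∈ extHalf m, 0 ≤ e q := by
    intro q hq
    simp only [he]
    rw [energy_identity hU T ε hq.1 (hL q hq.1 hq.2)]
    by_cases hd : 0 < depth T ε q
    · refine mul_nonneg (mul_nonneg (by positivity) (expNegInvGlue.nonneg _)) ?_
      by_cases h1 : q.1.2 + q.2 < -1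
      · simp [hearlyD _ q (openHalf_subset hq.1) h1]
      · have := hfac q hq hd h1
        positivity
    · rw [expNegInvGlue.zero_of_nonpos (not_lt.mp hd)]; simp
  have hae : e =ᵐ[volume.restrict (extHalf m)] 0 :=
    (setIntegral_eq_zero_iff_of_nonneg_ae
      ((ae_restrict_iff' isOpen_extHalf.measurableSet).2 (Eventually.of_forall hnn))
      hAdm.integrableOn_ext).1 hzero
  have hcl : extHalf m ⊆ halfSpace (Sp m) := fun q hq => openHalf_subset hq.1
  have heq := Measure.eqOn_open_of_ae_eq hae isOpen_extHalf
    (hAdm.smooth.continuousOn.mono hcl) continuousOn_const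
  have h0 : e p = 0 := heq hp
  simp only [he] at h0
  rw [energy_identity hU T ε hp.1 (hL p hp.1 hp.2)] at h0
  by_cases h1 : p.1.2 + p.2 < -1
  · exact hearlyD es p (hcl hp) h1
  have hf := hfac p hp hdepth h1
  have hk : 0 < (depth T ε p)⁻¹ ^ 2 * expNegInvGlue (depth T ε p) :=
    mul_pos (by positivity) (expNegInvGlue.pos_of_pos hdepth)
  have h3 := (mul_eq_zero.1 h0).resolve_left hk.ne'
  have hs1 : 0 ≤ ∑ i, (D (ey i) U p - 2 * ε * p.1.1 i * D es U p) ^ 2 := by positivity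
  have hs2 := sq_nonneg (D ez U p - (2 * ε * p.1.2 + 1) * D es U p)
  have hs3 : 0 ≤ D es U p ^ 2 * (1 - 4 * ε ^ 2 * normSq p.1) := by positivity
  have h4 : D es U p ^ 2 * (1 - 4 * ε ^ 2 * normSq p.1) = 0 := by linarith
  exact pow_eq_zero_iff (two_ne_zero) |>.1 ((mul_eq_zero.1 h4).resolve_right hf.ne')

/-- A wave that vanishes on the incoming front, for early times and on the unit sphere up to time
`T` vanishes outside the unit ball up to time `T`. -/
theorem exterior_vanishing {T : ℝ} (hT : 0 ≤ T) {U : SpT m → ℝ} (hU : SmoothHalf U)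
    (hL : ∀ p : SpT m, 0 < p.2 → 1 < normSq p.1 → Lop U p = 0)
    (hinit : ∀ x : Sp m, 1 ≤ normSq x → U (x, 0) = 0)
    (hearly : ∀ p ∈ halfSpace (Sp m), p.1.2 + p.2 < -1 → U p = 0)
    (hsph : ∀ p ∈ halfSpace (Sp m), normSq p.1 = 1 → p.1.2 + p.2 ≤ T → U p = 0)
    {p : SpT m} (hp : p ∈ halfSpace (Sp m)) (h1 : 1 ≤ normSq p.1) (hlt : p.1.2 + p.2 < T) :
    U p = 0 := by
  rcases h1.eq_or_lt with h1 | h1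
  · exact hsph p hp h1.symm hlt.le
  obtain ⟨x, s⟩ := p
  have hs0 : 0 ≤ s := hp
  replace h1 : 1 < normSq x := h1
  simp only at hlt
  have hx0 := hinit x h1.le
  rcases hs0.eq_or_lt with rfl | hs
  · exact hx0
  set ε := min (1 / (8 * (T + 1))) ((T - (x.2 + s)) / (2 * normSq x)) with hε
  have hε0 : 0 < ε := lt_min (by positivity) (div_pos (by linarith) (by linarith))
  have hε1 : 4 * ε * (T + 1) < 1 := by
    have : ε * (8 * (T + 1)) ≤ 1 := (le_div_iff₀ (by positivity)).1 (min_le_left _ _)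
    linarith
  have hε2 : ε * (2 * normSq x) ≤ T - (x.2 + s) :=
    (le_div_iff₀ (by linarith)).1 (min_le_right _ _)
  have hder : ∀ r ∈ Ioo 0 s, HasDerivAt (fun r : ℝ => U (x, r)) (D es U (x, r)) r :=
    fun r hr => SmoothHalf.hasDerivAt_vertical hU hr.1
  obtain ⟨r, hr, hreq⟩ := exists_hasDerivAt_eq_slope (fun r : ℝ => U (x, r))
    (fun r => D es U (x, r)) hs
    ((SmoothHalf.continuousOn_vertical hU x).mono Icc_subset_Ici_self) hder
  have hz : D es U (x, r) = 0 := by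
    refine ds_eq_zero_exterior hε0 hε1 hU hL hinit hearly hsph ⟨hr.1, h1⟩ ?_
    change 0 < T - (x.2 + r + ε * normSq x)
    nlinarith [hr.2]
  rw [hz, hx0, sub_zero, eq_comm, div_eq_zero_iff] at hreq
  exact hreq.resolve_right (by linarith)

/-- The squared distance from `x` to the point `(0, a)` of the axis. -/
noncomputable def distSq (a : ℝ) (x : Sp m) : ℝ := ∑ i, x.1 i ^ 2 + (x.2 - a) ^ 2

/-- The Carleman weight. -/
noncomputable def phi (a : ℝ) (p : SpT m) : ℝ := 5 * distSq a p.1 - p.2 ^ 2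

/-- The squared Lorentzian length of the gradient of `phi a`. -/
noncomputable def phiGrad (a : ℝ) (p : SpT m) : ℝ := 100 * distSq a p.1 + 40 * (p.1.2 - a) * p.2

/-- The derivative along the Lorentzian gradient of `phi a`. -/
noncomputable def radial (a : ℝ) (V : SpT m → ℝ) (p : SpT m) : ℝ :=
  ∑ i, 10 * p.1.1 i * D (ey i) V p + (10 * (p.1.2 - a) + 2 * p.2) * D ez V p
    - 10 * (p.1.2 - a) * D es V p

/-- The multiplier of the Carleman identity. -/
noncomputable def multiplier (a : ℝ) (V : SpT m → ℝ) (p : SpT m) : ℝ := radial a V p + 5 * m * V p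

/-- The Lagrangian density of the conjugated operator. -/
noncomputable def lagr (a σ : ℝ) (V : SpT m → ℝ) (p : SpT m) : ℝ :=
  ∑ i, D (ey i) V p ^ 2 + D ez V p ^ 2 - 2 * (D ez V p * D es V p)
    - σ ^ 2 * (phiGrad a p * V p ^ 2)

theorem lineDeriv_zsub (a : ℝ) (p v : SpT m) :
    HasLineDerivAt ℝ (fun q : SpT m => q.1.2 - a) v.1.2 p v := by
  have hc : HasLineDerivAt ℝ (fun _ : SpT m => a) 0 p v := hasDerivAt_const _ _
  have h := lineDeriv_sub (lineDeriv_z p v) hc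
  rwa [sub_zero] at h

theorem lineDeriv_distSq (a : ℝ) (p v : SpT m) :
    HasLineDerivAt ℝ (fun q : SpT m => distSq a q.1)
      (∑ j, 2 * p.1.1 j * v.1.1 j + 2 * (p.1.2 - a) * v.1.2) p v :=
  lineDeriv_add (lineDeriv_sum fun j => lineDeriv_sq (lineDeriv_coord j p v))
    (lineDeriv_sq (lineDeriv_zsub a p v))

theorem contDiff_zsub (a : ℝ) : ContDiff ℝ ∞ (fun p : SpT m => p.1.2 - a) :=
  (contDiff_snd.comp contDiff_fst).sub contDiff_const

theorem contDiff_distSq (a : ℝ) : ContDiff ℝ ∞ (fun p : SpT m => distSq a p.1) :=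
  (ContDiff.sum fun j _ => (contDiff_coord j).pow 2).add ((contDiff_zsub a).pow 2)

theorem contDiff_phi (a : ℝ) : ContDiff ℝ ∞ (phi a : SpT m → ℝ) :=
  (contDiff_const.mul (contDiff_distSq a)).sub (contDiff_snd.pow 2)

theorem contDiff_phiGrad (a : ℝ) : ContDiff ℝ ∞ (phiGrad a : SpT m → ℝ) :=
  (contDiff_const.mul (contDiff_distSq a)).add
    ((contDiff_const.mul (contDiff_zsub a)).mul contDiff_snd)

theorem adm_radial (a : ℝ) {V : SpT m → ℝ} (hV : Adm V) : Adm (radial a V) :=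
  ((Adm.sum fun i => Adm.mul_left
      (SmoothHalf.of_contDiff (contDiff_const.mul (contDiff_coord i))) (hV.D (ey i))).add
    (Adm.mul_left (SmoothHalf.of_contDiff ((contDiff_const.mul (contDiff_zsub a)).add
      (contDiff_const.mul contDiff_snd))) (hV.D ez))).sub
    (Adm.mul_left (SmoothHalf.of_contDiff (contDiff_const.mul (contDiff_zsub a))) (hV.D es))

theorem adm_multiplier (a : ℝ) {V : SpT m → ℝ} (hV : Adm V) : Adm (multiplier a V) :=
  (adm_radial a hV).add (hV.const_mul _)

theorem adm_lagr (a σ : ℝ) {V : SpT m → ℝ} (hV : Adm V) : Adm (lagr a σ V) :=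
  (((Adm.sum fun i => (hV.D (ey i)).sq).add (hV.D ez).sq).sub
    (((hV.D ez).mul (hV.D es)).const_mul 2)).sub
    ((Adm.mul_left (SmoothHalf.of_contDiff (contDiff_phiGrad a)) hV.sq).const_mul (σ ^ 2))

theorem D_multiplier (a : ℝ) {V : SpT m → ℝ} (hV : Adm V) {p : SpT m} (hp : 0 < p.2)
    (v : SpT m) : D v (multiplier a V) p =
      ∑ i, 10 * v.1.1 i * D (ey i) V p + ∑ i, 10 * p.1.1 i * D v (D (ey i) V) p
      + (10 * v.1.2 + 2 * v.2) * D ez V p + (10 * (p.1.2 - a) + 2 * p.2) * D v (D ez V) p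
      - 10 * v.1.2 * D es V p - 10 * (p.1.2 - a) * D v (D es V) p + 5 * m * D v V p := by
  have hd : ∀ w : SpT m, HasLineDerivAt ℝ (D w V) (D v (D w V) p) p v :=
    fun w => (hV.smooth.D w).hasLineDerivAt hp v
  have h := lineDeriv_add (lineDeriv_sub (lineDeriv_add
    (lineDeriv_sum (s := Finset.univ) fun i => lineDeriv_mul (lineDeriv_const_mul 10 (lineDeriv_coord i p v)) (hd (ey i)))
    (lineDeriv_mul (lineDeriv_add (lineDeriv_const_mul 10 (lineDeriv_zsub a p v))
      (lineDeriv_const_mul 2 (lineDeriv_s p v))) (hd ez)))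
    (lineDeriv_mul (lineDeriv_const_mul 10 (lineDeriv_zsub a p v)) (hd es)))
    (lineDeriv_const_mul (5 * (m : ℝ)) (hV.smooth.hasLineDerivAt hp v))
  rw [(adm_multiplier a hV).smooth.D_eq hp h, Finset.sum_add_distrib]
  ring

theorem D_lagr (a σ : ℝ) {V : SpT m → ℝ} (hV : Adm V) {p : SpT m} (hp : 0 < p.2)
    (v : SpT m) : D v (lagr a σ V) p =
      ∑ i, 2 * D (ey i) V p * D v (D (ey i) V) p + 2 * D ez V p * D v (D ez V) p
      - 2 * (D v (D ez V) p * D es V p + D ez V p * D v (D es V) p)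
      - σ ^ 2 * ((100 * (∑ j, 2 * p.1.1 j * v.1.1 j + 2 * (p.1.2 - a) * v.1.2)
        + (40 * v.1.2 * p.2 + 40 * (p.1.2 - a) * v.2)) * V p ^ 2
        + phiGrad a p * (2 * V p * D v V p)) := by
  have hd : ∀ w : SpT m, HasLineDerivAt ℝ (D w V) (D v (D w V) p) p v :=
    fun w => (hV.smooth.D w).hasLineDerivAt hp v
  have h := lineDeriv_sub (lineDeriv_sub (lineDeriv_add
    (lineDeriv_sum (s := Finset.univ) fun i => lineDeriv_sq (hd (ey i))) (lineDeriv_sq (hd ez)))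
    (lineDeriv_const_mul 2 (lineDeriv_mul (hd ez) (hd es))))
    (lineDeriv_const_mul (σ ^ 2) (lineDeriv_mul (lineDeriv_add
      (lineDeriv_const_mul 100 (lineDeriv_distSq a p v))
      (lineDeriv_mul (lineDeriv_const_mul 40 (lineDeriv_zsub a p v)) (lineDeriv_s p v)))
      (lineDeriv_sq (hV.smooth.hasLineDerivAt hp v))))
  exact (adm_lagr a σ hV).smooth.D_eq hp h

/-- The quadratic form in the gradient produced by the Carleman identity. -/
noncomputable def gradForm (V : SpT m → ℝ) (p : SpT m) : ℝ :=
  5 * ∑ i, D (ey i) V p ^ 2 + 3 * D ez V p ^ 2 - 10 * (D ez V p * D es V p) + 10 * D es V p ^ 2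

/-- The coefficient of `σ² V²` produced by the Carleman identity. -/
noncomputable def zeroCoeff (a : ℝ) (p : SpT m) : ℝ :=
  1500 * ∑ i, p.1.1 i ^ 2 + 1300 * (p.1.2 - a) ^ 2 + 600 * (p.1.2 - a) * p.2 + 40 * p.2 ^ 2

noncomputable def fluxY (a σ : ℝ) (V : SpT m → ℝ) (i : Fin m) (p : SpT m) : ℝ :=
  5 * p.1.1 i * lagr a σ V p - D (ey i) V p * multiplier a V p

noncomputable def fluxZ (a σ : ℝ) (V : SpT m → ℝ) (p : SpT m) : ℝ :=
  (5 * (p.1.2 - a) + p.2) * lagr a σ V p - (D ez V p - D es V p) * multiplier a V p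

noncomputable def fluxS (a σ : ℝ) (V : SpT m → ℝ) (p : SpT m) : ℝ :=
  D ez V p * multiplier a V p - 5 * (p.1.2 - a) * lagr a σ V p

theorem adm_fluxY (a σ : ℝ) {V : SpT m → ℝ} (hV : Adm V) (i : Fin m) : Adm (fluxY a σ V i) :=
  (Adm.mul_left (SmoothHalf.of_contDiff (contDiff_const.mul (contDiff_coord i)))
    (adm_lagr a σ hV)).sub ((hV.D _).mul (adm_multiplier a hV))

theorem adm_fluxZ (a σ : ℝ) {V : SpT m → ℝ} (hV : Adm V) : Adm (fluxZ a σ V) :=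
  (Adm.mul_left (SmoothHalf.of_contDiff ((contDiff_const.mul (contDiff_zsub a)).add contDiff_snd))
    (adm_lagr a σ hV)).sub (((hV.D _).sub (hV.D _)).mul (adm_multiplier a hV))

theorem adm_fluxS (a σ : ℝ) {V : SpT m → ℝ} (hV : Adm V) : Adm (fluxS a σ V) :=
  ((hV.D _).mul (adm_multiplier a hV)).sub
    (Adm.mul_left (SmoothHalf.of_contDiff (contDiff_const.mul (contDiff_zsub a)))
    (adm_lagr a σ hV))

theorem carleman_identity (a σ : ℝ) {V : SpT m → ℝ} (hV : Adm V) {p : SpT m} (hp : 0 < p.2) :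
    -(Lop V p + σ ^ 2 * phiGrad a p * V p) * multiplier a V p =
      gradForm V p + σ ^ 2 * zeroCoeff a p * V p ^ 2
      + (∑ i, D (ey i) (fluxY a σ V i) p + D ez (fluxZ a σ V) p + D es (fluxS a σ V) p) := by
  have hd : ∀ v w : SpT m, HasLineDerivAt ℝ (D w V) (D v (D w V) p) p v :=
    fun v w => (hV.smooth.D w).hasLineDerivAt hp v
  have hN : ∀ v, HasLineDerivAt ℝ (multiplier a V) (D v (multiplier a V) p) p v :=
    fun v => (adm_multiplier a hV).smooth.hasLineDerivAt hp v
  have hK : ∀ v, HasLineDerivAt ℝ (lagr a σ V) (D v (lagr a σ V) p) p v :=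
    fun v => (adm_lagr a σ hV).smooth.hasLineDerivAt hp v
  have hY : ∀ i, D (ey i) (fluxY a σ V i) p =
      5 * lagr a σ V p + 5 * p.1.1 i * D (ey i) (lagr a σ V) p
      - (D (ey i) (D (ey i) V) p * multiplier a V p
        + D (ey i) V p * D (ey i) (multiplier a V) p) := by
    intro i
    rw [(adm_fluxY a σ hV i).smooth.D_eq hp (lineDeriv_sub (lineDeriv_mul
      (lineDeriv_const_mul 5 (lineDeriv_coord i p (ey i))) (hK (ey i)))
      (lineDeriv_mul (hd (ey i) (ey i)) (hN (ey i))))]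
    simp
  have hZ : D ez (fluxZ a σ V) p =
      5 * lagr a σ V p + (5 * (p.1.2 - a) + p.2) * D ez (lagr a σ V) p
      - ((D ez (D ez V) p - D ez (D es V) p) * multiplier a V p
        + (D ez V p - D es V p) * D ez (multiplier a V) p) := by
    rw [(adm_fluxZ a σ hV).smooth.D_eq hp (lineDeriv_sub (lineDeriv_mul (lineDeriv_add
      (lineDeriv_const_mul 5 (lineDeriv_zsub a p ez)) (lineDeriv_s p ez)) (hK ez))
      (lineDeriv_mul (lineDeriv_sub (hd ez ez) (hd ez es)) (hN ez)))]
    simp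
  have hS : D es (fluxS a σ V) p =
      D ez (D es V) p * multiplier a V p + D ez V p * D es (multiplier a V) p
      - 5 * (p.1.2 - a) * D es (lagr a σ V) p := by
    rw [(adm_fluxS a σ hV).smooth.D_eq hp (lineDeriv_sub (lineDeriv_mul (hd es ez) (hN es))
      (lineDeriv_mul (lineDeriv_const_mul 5 (lineDeriv_zsub a p es)) (hK es)))]
    rw [hV.smooth.D_comm hp es ez]
    simp
  have hdouble : ∑ i, p.1.1 i * ∑ j, D (ey j) V p * D (ey i) (D (ey j) V) p =
      ∑ i, D (ey i) V p * ∑ j, p.1.1 j * D (ey i) (D (ey j) V) p := by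
    simp only [Finset.mul_sum]
    rw [Finset.sum_comm]
    refine Finset.sum_congr rfl fun i _ => Finset.sum_congr rfl fun j _ => ?_
    rw [hV.smooth.D_comm hp (ey j) (ey i)]
    ring
  have e1 : ∑ i, D (ey i) (fluxY a σ V i) p =
      5 * m * lagr a σ V p - (∑ i, D (ey i) (D (ey i) V) p) * multiplier a V p
      + (10 * (∑ i, p.1.1 i * ∑ j, D (ey j) V p * D (ey i) (D (ey j) V) p)
        + 10 * D ez V p * (∑ i, p.1.1 i * D (ey i) (D ez V) p)
        - 10 * ((∑ i, p.1.1 i * D (ey i) (D ez V) p) * D es V p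
          + D ez V p * (∑ i, p.1.1 i * D (ey i) (D es V) p))
        - σ ^ 2 * (1000 * (∑ i, p.1.1 i ^ 2) * V p ^ 2
          + 10 * phiGrad a p * V p * (∑ i, p.1.1 i * D (ey i) V p)))
      - ((10 + 5 * m) * (∑ i, D (ey i) V p ^ 2)
        + 10 * (∑ i, D (ey i) V p * ∑ j, p.1.1 j * D (ey i) (D (ey j) V) p)
        + (10 * (p.1.2 - a) + 2 * p.2) * (∑ i, D (ey i) V p * D (ey i) (D ez V) p)
        - 10 * (p.1.2 - a) * (∑ i, D (ey i) V p * D (ey i) (D es V) p)) := by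
    have hc : 5 * m * lagr a σ V p = ∑ _i : Fin m, 5 * lagr a σ V p := by
      simp; ring
    have hi : ∀ i, D (ey i) (fluxY a σ V i) p = 5 * lagr a σ V p
        - D (ey i) (D (ey i) V) p * multiplier a V p
        + (10 * (p.1.1 i * ∑ j, D (ey j) V p * D (ey i) (D (ey j) V) p)
          + 10 * D ez V p * (p.1.1 i * D (ey i) (D ez V) p)
          - 10 * (p.1.1 i * D (ey i) (D ez V) p * D es V p
            + D ez V p * (p.1.1 i * D (ey i) (D es V) p))
          - σ ^ 2 * (1000 * p.1.1 i ^ 2 * V p ^ 2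
            + 10 * phiGrad a p * V p * (p.1.1 i * D (ey i) V p)))
        - ((10 + 5 * m) * D (ey i) V p ^ 2
          + 10 * (D (ey i) V p * ∑ j, p.1.1 j * D (ey i) (D (ey j) V) p)
          + (10 * (p.1.2 - a) + 2 * p.2) * (D (ey i) V p * D (ey i) (D ez V) p)
          - 10 * (p.1.2 - a) * (D (ey i) V p * D (ey i) (D es V) p)) := by
      intro i
      rw [hY, D_lagr a σ hV hp, D_multiplier a hV hp]
      have s1 : ∑ j, 10 * (ey i : SpT m).1.1 j * D (ey j) V p = 10 * D (ey i) V p := by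
        simp [PiLp.single_apply]
      have s2 : ∑ j, 2 * D (ey j) V p * D (ey i) (D (ey j) V) p =
          2 * ∑ j, D (ey j) V p * D (ey i) (D (ey j) V) p := by
        simp only [Finset.mul_sum, mul_assoc]
      have s3 : ∑ j, 10 * p.1.1 j * D (ey i) (D (ey j) V) p =
          10 * ∑ j, p.1.1 j * D (ey i) (D (ey j) V) p := by
        simp only [Finset.mul_sum, mul_assoc]
      rw [s1, s2, s3, sum_mul_single]
      ring
    rw [hc]
    simp only [hi, Finset.sum_add_distrib, Finset.sum_sub_distrib, ← Finset.mul_sum,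
      ← Finset.sum_mul]
  rw [e1, hZ, hS, hdouble]
  simp only [D_lagr a σ hV hp, D_multiplier a hV hp]
  unfold lagr multiplier radial gradForm zeroCoeff phiGrad distSq Lop
  simp only [hV.smooth.D_comm hp es]
  simp
  have c1 : ∀ w, ∑ i, 2 * D (ey i) V p * D w (D (ey i) V) p =
      2 * ∑ i, D (ey i) V p * D (ey i) (D w V) p := fun w => by
    simp only [Finset.mul_sum, mul_assoc, hV.smooth.D_comm hp w]
  have c2 : ∀ w, ∑ i, 10 * p.1.1 i * D w (D (ey i) V) p =
      10 * ∑ i, p.1.1 i * D (ey i) (D w V) p := fun w => by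
    simp only [Finset.mul_sum, mul_assoc, hV.smooth.D_comm hp w]
  have c3 : ∑ i, 10 * p.1.1 i * D (ey i) V p = 10 * ∑ i, p.1.1 i * D (ey i) V p := by
    simp only [Finset.mul_sum, mul_assoc]
  have c4 : ∀ w, ∑ i, 2 * D (ey i) V p * D (ey i) (D w V) p =
      2 * ∑ i, D (ey i) V p * D (ey i) (D w V) p := fun w => by
    simp only [Finset.mul_sum, mul_assoc]
  have c5 : ∀ w, ∑ i, 10 * p.1.1 i * D (ey i) (D w V) p =
      10 * ∑ i, p.1.1 i * D (ey i) (D w V) p := fun w => by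
    simp only [Finset.mul_sum, mul_assoc]
  rw [c1 ez, c2 ez, c3, c4 es, c5 es]
  ring

/-- The wave operator conjugated by `exp (σ * phi a)`. -/
noncomputable def conjOp (a σ : ℝ) (V : SpT m → ℝ) (p : SpT m) : ℝ :=
  Lop V p - 2 * σ * radial a V p - σ * (10 * m + 10) * V p + σ ^ 2 * (phiGrad a p * V p)

/-- The full squared gradient. -/
noncomputable def gradSq (V : SpT m → ℝ) (p : SpT m) : ℝ :=
  ∑ i, D (ey i) V p ^ 2 + D ez V p ^ 2 + D es V p ^ 2

theorem adm_Lop {V : SpT m → ℝ} (hV : Adm V) : Adm (Lop V) :=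
  ((Adm.sum fun _ => (hV.D _).D _).add ((hV.D _).D _)).sub (((hV.D _).D _).const_mul 2)

theorem adm_conjOp (a σ : ℝ) {V : SpT m → ℝ} (hV : Adm V) : Adm (conjOp a σ V) :=
  (((adm_Lop hV).sub ((adm_radial a hV).const_mul _)).sub (hV.const_mul _)).add
    ((Adm.mul_left (SmoothHalf.of_contDiff (contDiff_phiGrad a)) hV).const_mul _)

theorem adm_gradSq {V : SpT m → ℝ} (hV : Adm V) : Adm (gradSq V) :=
  ((Adm.sum fun _ => (hV.D _).sq).add (hV.D _).sq).add (hV.D _).sq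

theorem carleman_inequality (a : ℝ) {σ : ℝ} (hσ : 0 < σ) {V : SpT m → ℝ} (hV : Adm V)
    (hsupp : ∀ p : SpT m, 0 < p.2 → V p ≠ 0 → 6 ≤ zeroCoeff a p) :
    4 / 5 * σ * (∫ p in openHalf (Sp m), gradSq V p)
      + 24 * σ ^ 3 * (∫ p in openHalf (Sp m), V p ^ 2)
    ≤ 2 * (∫ p in openHalf (Sp m), conjOp a σ V p ^ 2)
      + 200 * σ ^ 2 * (∫ p in openHalf (Sp m), V p ^ 2)
      + 4 * σ * ∫ x : Sp m, fluxS a σ V (x, 0) := by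
  set dv : SpT m → ℝ := fun p =>
    ∑ i, D (ey i) (fluxY a σ V i) p + D ez (fluxZ a σ V) p + D es (fluxS a σ V) p with hdv
  have hdvA : Adm dv := ((Adm.sum fun i => (adm_fluxY a σ hV i).D _).add
    ((adm_fluxZ a σ hV).D _)).add ((adm_fluxS a σ hV).D _)
  have hdiv : ∫ p in openHalf (Sp m), dv p = -∫ x : Sp m, fluxS a σ V (x, 0) := by
    rw [hdv, integral_add ((Adm.sum fun i => (adm_fluxY a σ hV i).D _).add
      ((adm_fluxZ a σ hV).D _)).integrableOn ((adm_fluxS a σ hV).D _).integrableOn,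
      integral_add (Adm.sum fun i => (adm_fluxY a σ hV i).D _).integrableOn
      ((adm_fluxZ a σ hV).D _).integrableOn,
      integral_finsetSum _ fun i _ => ((adm_fluxY a σ hV i).D _).integrableOn,
      (adm_fluxZ a σ hV).integral_D_horizontal, (adm_fluxS a σ hV).integral_D_vertical]
    simp [(adm_fluxY a σ hV _).integral_D_horizontal]
  have hpt : ∀ p ∈ openHalf (Sp m), (4 / 5 * σ * gradSq V p + 24 * σ ^ 3 * V p ^ 2) + 4 * σ * dv p ≤
      2 * conjOp a σ V p ^ 2 + 200 * σ ^ 2 * V p ^ 2 := by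
    intro p hp
    have hid := carleman_identity a σ hV hp
    have h1 : conjOp a σ V p + 10 * σ * V p =
        (Lop V p + σ ^ 2 * phiGrad a p * V p) - 2 * σ * multiplier a V p := by
      unfold conjOp multiplier; ring
    have h2 : 6 * V p ^ 2 ≤ zeroCoeff a p * V p ^ 2 := by
      by_cases h0 : V p = 0
      · simp [h0]
      · exact mul_le_mul_of_nonneg_right (hsupp p hp h0) (sq_nonneg _)
    have h3 : 1 / 5 * gradSq V p ≤ gradForm V p := by
      unfold gradSq gradForm
      have : 0 ≤ ∑ i, D (ey i) V p ^ 2 := Finset.sum_nonneg fun i _ => sq_nonneg _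
      nlinarith [sq_nonneg (14 * D ez V p - 25 * D es V p), sq_nonneg (D es V p),
        sq_nonneg (D ez V p)]
    set P := Lop V p + σ ^ 2 * phiGrad a p * V p
    set N := multiplier a V p
    have h4 : 4 * σ * (-P * N) ≤ (conjOp a σ V p + 10 * σ * V p) ^ 2 := by
      rw [h1]; nlinarith [sq_nonneg P, sq_nonneg (σ * N)]
    have h5 : (conjOp a σ V p + 10 * σ * V p) ^ 2 ≤ 2 * conjOp a σ V p ^ 2
        + 200 * σ ^ 2 * V p ^ 2 := by
      nlinarith [sq_nonneg (conjOp a σ V p - 10 * σ * V p)]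
    rw [hid] at h4
    have h6 : σ * (1 / 5 * gradSq V p) ≤ σ * gradForm V p := mul_le_mul_of_nonneg_left h3 hσ.le
    have h7 : σ ^ 3 * (6 * V p ^ 2) ≤ σ ^ 3 * (zeroCoeff a p * V p ^ 2) :=
      mul_le_mul_of_nonneg_left h2 (by positivity)
    change _ + 4 * σ * (∑ i, D (ey i) (fluxY a σ V i) p + D ez (fluxZ a σ V) p
      + D es (fluxS a σ V) p) ≤ _
    nlinarith
  have hInt := setIntegral_mono_on
    ((((adm_gradSq hV).const_mul (4 / 5 * σ)).add (hV.sq.const_mul (24 * σ ^ 3))).add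
      (hdvA.const_mul (4 * σ))).integrableOn
    (((adm_conjOp a σ hV).sq.const_mul 2).add (hV.sq.const_mul (200 * σ ^ 2))).integrableOn
    isOpen_openHalf.measurableSet hpt
  rw [integral_add (((adm_gradSq hV).const_mul (4 / 5 * σ)).add
      (hV.sq.const_mul (24 * σ ^ 3))).integrableOn (hdvA.const_mul (4 * σ)).integrableOn,
    integral_add ((adm_gradSq hV).const_mul (4 / 5 * σ)).integrableOn
      (hV.sq.const_mul (24 * σ ^ 3)).integrableOn,
    integral_add ((adm_conjOp a σ hV).sq.const_mul 2).integrableOn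
      (hV.sq.const_mul (200 * σ ^ 2)).integrableOn] at hInt
  simp only [integral_const_mul] at hInt
  rw [hdiv] at hInt
  linarith

theorem integral_trace_sq_D_ez {V : SpT m → ℝ} (hV : Adm V) :
    ∫ x : Sp m, D ez V (x, 0) ^ 2 = ∫ p in openHalf (Sp m), D ez V p * Lop V p := by
  have hA : ∀ i, Adm (fun q => D ez V q * D (ey i) V q) := fun i => (hV.D _).mul (hV.D _)
  have hB : Adm (fun q => ∑ i, D (ey i) V q ^ 2) := Adm.sum fun i => (hV.D _).sq
  have hC : Adm (fun q => D ez V q ^ 2) := (hV.D _).sq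
  have hpt : ∀ p ∈ openHalf (Sp m), D ez V p * Lop V p =
      ((∑ i, D (ey i) (fun q => D ez V q * D (ey i) V q) p
        - 1 / 2 * D ez (fun q => ∑ i, D (ey i) V q ^ 2) p)
        + 1 / 2 * D ez (fun q => D ez V q ^ 2) p) - D es (fun q => D ez V q ^ 2) p := by
    intro p hp
    have hd : ∀ v w : SpT m, HasLineDerivAt ℝ (D w V) (D v (D w V) p) p v :=
      fun v w => (hV.smooth.D w).hasLineDerivAt hp v
    have h1 : ∀ i, D (ey i) (fun q => D ez V q * D (ey i) V q) p =
        D ez (D (ey i) V) p * D (ey i) V p + D ez V p * D (ey i) (D (ey i) V) p := fun i => by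
      rw [(hA i).smooth.D_eq hp (lineDeriv_mul (hd _ _) (hd _ _)), hV.smooth.D_comm hp (ey i) ez]
    have h2 : D ez (fun q => ∑ i, D (ey i) V q ^ 2) p =
        2 * ∑ i, D ez (D (ey i) V) p * D (ey i) V p := by
      rw [hB.smooth.D_eq hp (lineDeriv_sum fun i => lineDeriv_sq (hd _ _)), Finset.mul_sum]
      exact Finset.sum_congr rfl fun i _ => by ring
    rw [hC.smooth.D_eq hp (lineDeriv_sq (hd ez ez)), hC.smooth.D_eq hp (lineDeriv_sq (hd es ez)),
      h2, hV.smooth.D_comm hp es ez]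
    simp only [h1, Finset.sum_add_distrib, ← Finset.mul_sum]
    unfold Lop
    ring
  rw [setIntegral_congr_fun isOpen_openHalf.measurableSet hpt,
    integral_sub (((Adm.sum fun i => (hA i).D _).sub ((hB.D _).const_mul _)).add
      ((hC.D _).const_mul _)).integrableOn (hC.D _).integrableOn,
    integral_add ((Adm.sum fun i => (hA i).D _).sub ((hB.D _).const_mul _)).integrableOn
      ((hC.D _).const_mul _).integrableOn,
    integral_sub (Adm.sum fun i => (hA i).D _).integrableOn ((hB.D _).const_mul _).integrableOn,
    integral_finsetSum _ fun i _ => ((hA i).D _).integrableOn, integral_const_mul,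
    integral_const_mul, hB.integral_D_horizontal, hC.integral_D_horizontal,
    hC.integral_D_vertical]
  simp [(hA _).integral_D_horizontal]

theorem integral_trace_sq {V : SpT m → ℝ} (hV : Adm V) :
    ∫ x : Sp m, V (x, 0) ^ 2 = ∫ p in openHalf (Sp m), -(2 * (V p * D es V p)) := by
  have h := hV.sq.integral_D_vertical
  rw [← neg_eq_iff_eq_neg.2 h, ← integral_neg]
  refine setIntegral_congr_fun isOpen_openHalf.measurableSet fun p hp => ?_
  rw [hV.sq.smooth.D_eq hp (lineDeriv_sq (hV.smooth.hasLineDerivAt hp es)), mul_assoc]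

theorem abs_coord_le {x : Sp m} (hx : normSq x ≤ 1) (i : Fin m) : |x.1 i| ≤ 1 := by
  rw [normSq_eq_sum] at hx
  have h1 : x.1 i ^ 2 ≤ ∑ j, x.1 j ^ 2 :=
    Finset.single_le_sum (f := fun j => x.1 j ^ 2) (fun j _ => sq_nonneg _) (Finset.mem_univ i)
  rw [← sq_le_one_iff_abs_le_one]
  nlinarith [sq_nonneg x.2]

theorem abs_z_le {x : Sp m} (hx : normSq x ≤ 1) : |x.2| ≤ 1 := by
  rw [← sq_le_one_iff_abs_le_one]
  unfold normSq at hx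
  nlinarith [sq_nonneg ‖x.1‖]

theorem trace_pointwise {a σ : ℝ} (ha : |a| ≤ 2) (hσ : 1 ≤ σ) (V : SpT m → ℝ) {p : SpT m}
    (hx : normSq p.1 ≤ 1) (hs0 : 0 ≤ p.2) (hs : p.2 ≤ 6) :
    D ez V p * Lop V p ≤ conjOp a σ V p ^ 2
      + (1300 + 15 * m) * (σ * gradSq V p + σ ^ 3 * V p ^ 2) := by
  have hz := abs_le.1 (abs_z_le hx)
  have ha' := abs_le.1 ha
  set r := p.1.2 - a with hr
  have hr1 : -3 ≤ r := by linarith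
  have hr2 : r ≤ 3 := by linarith
  set s := p.2
  set A := ∑ i, D (ey i) V p ^ 2
  have hA : 0 ≤ A := Finset.sum_nonneg fun i _ => sq_nonneg _
  set b := D ez V p
  set c := D es V p
  have hsum : b * ∑ i, 10 * p.1.1 i * D (ey i) V p ≤ 5 * A + 5 * m * b ^ 2 := by
    have : 5 * A + 5 * m * b ^ 2 = ∑ i : Fin m, (5 * D (ey i) V p ^ 2 + 5 * b ^ 2) := by
      rw [Finset.sum_add_distrib, ← Finset.mul_sum]; simp; ring
    rw [this, Finset.mul_sum]
    refine Finset.sum_le_sum fun i _ => ?_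
    have hy := abs_le.1 (abs_coord_le hx i)
    have h1 := mul_nonneg (sub_nonneg.2 hy.2) (sq_nonneg (b + D (ey i) V p))
    have h2 := mul_nonneg (sub_nonneg.2 hy.1) (sq_nonneg (b - D (ey i) V p))
    nlinarith
  have hrad : b * radial a V p ≤ (100 + 5 * m) * gradSq V p := by
    have e : b * radial a V p = b * ∑ i, 10 * p.1.1 i * D (ey i) V p + (10 * r + 2 * s) * b ^ 2
      - 10 * r * (b * c) := by unfold radial; ring
    have h1 : (10 * r + 2 * s) * b ^ 2 ≤ 42 * b ^ 2 :=
      mul_le_mul_of_nonneg_right (by linarith) (sq_nonneg _)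
    have h2 : - (10 * r * (b * c)) ≤ 15 * (b ^ 2 + c ^ 2) := by
      nlinarith [mul_nonneg (sub_nonneg.2 hr2) (sq_nonneg (b - c)),
        mul_nonneg (sub_nonneg.2 hr1) (sq_nonneg (b + c))]
    have hg : gradSq V p = A + b ^ 2 + c ^ 2 := rfl
    have hm : (0 : ℝ) ≤ m := Nat.cast_nonneg m
    rw [e, hg]
    nlinarith [mul_nonneg hm hA, mul_nonneg hm (sq_nonneg c), sq_nonneg b, sq_nonneg c]
  have hb : b ^ 2 ≤ gradSq V p := by
    have hg : gradSq V p = A + b ^ 2 + c ^ 2 := rfl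
    nlinarith [sq_nonneg c]
  have hg0 : 0 ≤ gradSq V p := (sq_nonneg b).trans hb
  set G := gradSq V p
  set v := V p
  have hgr : |phiGrad a p| ≤ 2000 := by
    have hd : phiGrad a p = 100 * (normSq p.1 - p.1.2 ^ 2 + r ^ 2) + 40 * r * s := by
      unfold phiGrad distSq; rw [normSq_eq_sum]; ring
    have hn := normSq_nonneg p.1
    have hyn : 0 ≤ normSq p.1 - p.1.2 ^ 2 := by unfold normSq; nlinarith [sq_nonneg ‖p.1.1‖]
    have hr9 : r ^ 2 ≤ 9 := by nlinarith
    have hrs : |r * s| ≤ 18 := by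
      rw [abs_mul]
      have h1 : |r| ≤ 3 := abs_le.2 ⟨hr1, hr2⟩
      have h2 : |s| ≤ 6 := abs_le.2 ⟨by linarith, hs⟩
      nlinarith [abs_nonneg r, abs_nonneg s]
    have := abs_le.1 hrs
    rw [hd, abs_le]
    constructor <;> nlinarith [sq_nonneg p.1.2, sq_nonneg r]
  have e : b * Lop V p = b * conjOp a σ V p + 2 * σ * (b * radial a V p)
      + σ * (10 * m + 10) * (b * v) - phiGrad a p * (σ ^ 2 * (b * v)) := by
    simp only [conjOp]; ring
  have hσG : G ≤ σ * G := le_mul_of_one_le_left hg0 hσ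
  have hσ0 : 0 ≤ σ := by linarith
  have t1 : b * conjOp a σ V p ≤ conjOp a σ V p ^ 2 + σ * G := by
    nlinarith [sq_nonneg (b - conjOp a σ V p), sq_nonneg (conjOp a σ V p), sq_nonneg b]
  have t2 : 2 * σ * (b * radial a V p) ≤ 2 * σ * ((100 + 5 * m) * G) :=
    mul_le_mul_of_nonneg_left hrad (by positivity)
  have hbv : |σ ^ 2 * (b * v)| ≤ 1 / 2 * (σ * G + σ ^ 3 * v ^ 2) := by
    rw [abs_le]
    have k1 := mul_nonneg hσ0 (sq_nonneg (b - σ * v))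
    have k2 := mul_nonneg hσ0 (sq_nonneg (b + σ * v))
    have k3 := mul_le_mul_of_nonneg_left hb hσ0
    constructor <;> linarith
  have hQ : 0 ≤ σ * G + σ ^ 3 * v ^ 2 := by positivity
  have hbv' : σ * (b * v) ≤ 1 / 2 * (σ * G + σ ^ 3 * v ^ 2) := by
    refine le_trans ?_ hbv
    refine (le_abs_self _).trans ?_
    rw [abs_mul, abs_mul (σ ^ 2), abs_of_nonneg hσ0, abs_of_nonneg (sq_nonneg σ)]
    exact mul_le_mul_of_nonneg_right (by nlinarith) (abs_nonneg _)
  have t3 : σ * (10 * m + 10) * (b * v) ≤ (5 * m + 5) * (σ * G + σ ^ 3 * v ^ 2) := by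
    have hm : (0 : ℝ) ≤ 10 * m + 10 := by positivity
    linarith [mul_le_mul_of_nonneg_left hbv' hm]
  have t4 : -(phiGrad a p * (σ ^ 2 * (b * v))) ≤ 1000 * (σ * G + σ ^ 3 * v ^ 2) := by
    refine (neg_le_abs _).trans ?_
    rw [abs_mul]
    linarith [mul_le_mul hgr hbv (abs_nonneg _) (by norm_num)]
  have hv : 0 ≤ σ ^ 3 * v ^ 2 := by positivity
  have hσG0 : 0 ≤ σ * G := by positivity
  have hm : (0 : ℝ) ≤ m := Nat.cast_nonneg m
  rw [e]
  linarith [mul_nonneg hm hv]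

theorem trace_bound {a σ : ℝ} (ha : |a| ≤ 2) (hσ : 1 ≤ σ) {V : SpT m → ℝ} (hV : Adm V)
    (hsupp : ∀ p ∈ halfSpace (Sp m), (1 < normSq p.1 ∨ 6 < p.2) → V p = 0) :
    ∫ x : Sp m, (D ez V (x, 0) - 10 * σ * (x.2 - a) * V (x, 0)) ^ 2 ≤
      2 * (∫ p in openHalf (Sp m), conjOp a σ V p ^ 2)
      + (4400 + 30 * m) * (σ * (∫ p in openHalf (Sp m), gradSq V p)
        + σ ^ 3 * ∫ p in openHalf (Sp m), V p ^ 2) := by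
  have hO : IsOpen {p : SpT m | 1 < normSq p.1 ∨ 6 < p.2} :=
    (isOpen_lt continuous_const (contDiff_normSq.continuous.comp continuous_fst)).union
      (isOpen_lt continuous_const continuous_snd)
  have hD0 : ∀ v : SpT m, ∀ p ∈ halfSpace (Sp m), (1 < normSq p.1 ∨ 6 < p.2) → D v V p = 0 :=
    fun v p hp h => D_eq_zero_on hO v (fun q hq hqH => hsupp q hqH hq) p h hp
  have hσ0 : 0 ≤ σ := by linarith
  set F := ∫ p in openHalf (Sp m), conjOp a σ V p ^ 2
  set E := ∫ p in openHalf (Sp m), gradSq V p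
  set M := ∫ p in openHalf (Sp m), V p ^ 2
  have hgn : ∀ p, 0 ≤ gradSq V p := fun p => by unfold gradSq; positivity
  have h1 : ∫ x : Sp m, D ez V (x, 0) ^ 2 ≤ F + (1300 + 15 * m) * (σ * E + σ ^ 3 * M) := by
    rw [integral_trace_sq_D_ez hV]
    have hi := setIntegral_mono_on ((hV.D ez).mul (adm_Lop hV)).integrableOn
      ((adm_conjOp a σ hV).sq.add ((((adm_gradSq hV).const_mul σ).add
        (hV.sq.const_mul (σ ^ 3))).const_mul (1300 + 15 * m))).integrableOn
      isOpen_openHalf.measurableSet (fun p hp => by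
        by_cases h : 1 < normSq p.1 ∨ 6 < p.2
        · rw [hD0 ez p (openHalf_subset hp) h, zero_mul]
          have := hgn p
          positivity
        · rw [not_or, not_lt, not_lt] at h
          exact trace_pointwise ha hσ V h.1 (le_of_lt hp) h.2)
    rw [integral_add (adm_conjOp a σ hV).sq.integrableOn ((((adm_gradSq hV).const_mul σ).add
        (hV.sq.const_mul (σ ^ 3))).const_mul (1300 + 15 * m)).integrableOn,
      integral_const_mul, integral_add ((adm_gradSq hV).const_mul σ).integrableOn
        (hV.sq.const_mul (σ ^ 3)).integrableOn, integral_const_mul, integral_const_mul] at hi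
    exact hi
  have h2 : σ ^ 2 * ∫ x : Sp m, V (x, 0) ^ 2 ≤ σ * E + σ ^ 3 * M := by
    rw [integral_trace_sq hV, ← integral_const_mul]
    have hi := setIntegral_mono_on
      ((((hV.mul (hV.D es)).const_mul 2).const_mul (-1)).const_mul (σ ^ 2)).integrableOn
      (((adm_gradSq hV).const_mul σ).add (hV.sq.const_mul (σ ^ 3))).integrableOn
      isOpen_openHalf.measurableSet (fun p hp => by
        have hs : D es V p ^ 2 ≤ gradSq V p := by
          unfold gradSq
          have : 0 ≤ ∑ i, D (ey i) V p ^ 2 := Finset.sum_nonneg fun i _ => sq_nonneg _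
          nlinarith [sq_nonneg (D ez V p)]
        nlinarith [mul_le_mul_of_nonneg_left hs hσ0,
          mul_nonneg hσ0 (sq_nonneg (D es V p + σ * V p))])
    rw [integral_add ((adm_gradSq hV).const_mul σ).integrableOn
        (hV.sq.const_mul (σ ^ 3)).integrableOn, integral_const_mul σ,
        integral_const_mul (σ ^ 3)] at hi
    simpa only [neg_one_mul] using hi
  have hT1 := ((hV.D ez).sq.const_mul 2).integrable_trace
  have hT2 := (hV.sq.const_mul (1800 * σ ^ 2)).integrable_trace
  have hT3 : Integrable (fun x : Sp m => (D ez V (x, 0) - 10 * σ * (x.2 - a) * V (x, 0)) ^ 2) :=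
    ((hV.D ez).sub (Adm.mul_left (SmoothHalf.of_contDiff
      (contDiff_const.mul (contDiff_zsub a))) hV)).sq.integrable_trace
  have h3 : ∫ x : Sp m, (D ez V (x, 0) - 10 * σ * (x.2 - a) * V (x, 0)) ^ 2 ≤
      ∫ x : Sp m, (2 * D ez V (x, 0) ^ 2 + 1800 * σ ^ 2 * V (x, 0) ^ 2) := by
    refine integral_mono hT3 (hT1.add hT2) fun x => ?_
    simp only
    by_cases h : 1 < normSq x
    · rw [hsupp (x, 0) (le_refl (0 : ℝ)) (Or.inl h)]
      nlinarith [sq_nonneg (D ez V (x, 0))]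
    · have hz := abs_le.1 (abs_z_le (not_lt.1 h))
      have ha' := abs_le.1 ha
      have hr : (x.2 - a) ^ 2 ≤ 9 := by nlinarith
      nlinarith [sq_nonneg (D ez V (x, 0) + 10 * σ * (x.2 - a) * V (x, 0)),
        mul_le_mul_of_nonneg_right hr (sq_nonneg (σ * V (x, 0)))]
  rw [integral_add hT1 hT2, integral_const_mul, integral_const_mul] at h3
  nlinarith

/-- The directional derivative of `phi a`. -/
noncomputable def phiD (a : ℝ) (v p : SpT m) : ℝ :=
  5 * (∑ j, 2 * p.1.1 j * v.1.1 j + 2 * (p.1.2 - a) * v.1.2) - 2 * p.2 * v.2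

theorem lineDeriv_phi (a : ℝ) (p v : SpT m) : HasLineDerivAt ℝ (phi a) (phiD a v p) p v :=
  lineDeriv_sub (lineDeriv_const_mul 5 (lineDeriv_distSq a p v)) (lineDeriv_sq (lineDeriv_s p v))

theorem lineDeriv_phiD (a : ℝ) (p v w : SpT m) : HasLineDerivAt ℝ (phiD a w)
    (5 * (∑ j, 2 * v.1.1 j * w.1.1 j + 2 * v.1.2 * w.1.2) - 2 * v.2 * w.2) p v := by
  have hm : ∀ {f : SpT m → ℝ} {f' : ℝ} (c : ℝ), HasLineDerivAt ℝ f f' p v →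
      HasLineDerivAt ℝ (fun q => 2 * f q * c) (2 * f' * c) p v :=
    fun c h => HasDerivAt.mul_const (HasDerivAt.const_mul 2 h) c
  exact lineDeriv_sub (lineDeriv_const_mul 5 (lineDeriv_add
    (lineDeriv_sum fun j => hm _ (lineDeriv_coord j p v)) (hm _ (lineDeriv_zsub a p v))))
    (hm _ (lineDeriv_s p v))

/-- The function `W` multiplied by the Carleman weight. -/
noncomputable def conj (a σ : ℝ) (W : SpT m → ℝ) (p : SpT m) : ℝ :=
  Real.exp (σ * phi a p) * W p

theorem contDiff_weight (a σ : ℝ) : ContDiff ℝ ∞ (fun p : SpT m => Real.exp (σ * phi a p)) :=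
  Real.contDiff_exp.comp (contDiff_const.mul (contDiff_phi a))

theorem adm_conj (a σ : ℝ) {W : SpT m → ℝ} (hW : Adm W) : Adm (conj a σ W) :=
  Adm.mul_left (SmoothHalf.of_contDiff (contDiff_weight a σ)) hW

theorem lineDeriv_weight (a σ : ℝ) (p v : SpT m) :
    HasLineDerivAt ℝ (fun p : SpT m => Real.exp (σ * phi a p))
      (Real.exp (σ * phi a p) * (σ * phiD a v p)) p v :=
  lineDeriv_comp (h := Real.exp) (f := fun q => σ * phi a q) (Real.hasDerivAt_exp _)
    (lineDeriv_const_mul σ (lineDeriv_phi a p v))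

theorem D_conj (a σ : ℝ) {W : SpT m → ℝ} (hW : Adm W) {p : SpT m} (hp : 0 < p.2) (v : SpT m) :
    D v (conj a σ W) p = Real.exp (σ * phi a p) * (D v W p + σ * (phiD a v p * W p)) := by
  rw [(adm_conj a σ hW).smooth.D_eq hp (lineDeriv_mul (lineDeriv_weight a σ p v)
    (hW.smooth.hasLineDerivAt hp v))]
  ring

theorem D_conj_trace (a σ : ℝ) {W : SpT m → ℝ} (hW : Adm W) (x : Sp m) :
    D ez (conj a σ W) (x, 0) - 10 * σ * (x.2 - a) * conj a σ W (x, 0) =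
      Real.exp (σ * phi a (x, 0)) * D ez W (x, 0) := by
  rw [(adm_conj a σ hW).smooth.D_eq_horizontal (p := (x, 0)) le_rfl
    (lineDeriv_mul (lineDeriv_weight a σ _ _)
    (hW.smooth.hasLineDerivAt_horizontal (p := (x, 0)) le_rfl _))]
  simp [phiD, conj]
  ring

theorem D_D_conj (a σ : ℝ) {W : SpT m → ℝ} (hW : Adm W) {p : SpT m} (hp : 0 < p.2)
    (v w : SpT m) :
    D v (D w (conj a σ W)) p = Real.exp (σ * phi a p) * (D v (D w W) p
      + σ * (phiD a v p * D w W p) + σ * (phiD a w p * D v W p)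
      + σ * ((5 * (∑ j, 2 * v.1.1 j * w.1.1 j + 2 * v.1.2 * w.1.2) - 2 * v.2 * w.2) * W p)
      + σ ^ 2 * (phiD a v p * phiD a w p * W p)) := by
  rw [D_eqOn isOpen_openHalf v (fun q hq _ => D_conj a σ hW hq w) p hp (openHalf_subset hp)]
  have hl := lineDeriv_mul (lineDeriv_weight a σ p v) (lineDeriv_add
    ((hW.smooth.D w).hasLineDerivAt hp v) (lineDeriv_const_mul σ
      (lineDeriv_mul (lineDeriv_phiD a p v w) (hW.smooth.hasLineDerivAt hp v))))
  have hphi : ContDiff ℝ ∞ (phiD a w : SpT m → ℝ) := by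
    unfold phiD
    exact (contDiff_const.mul ((ContDiff.sum fun j _ =>
      (contDiff_const.mul (contDiff_coord j)).mul contDiff_const).add
      ((contDiff_const.mul (contDiff_zsub a)).mul contDiff_const))).sub
      ((contDiff_const.mul contDiff_snd).mul contDiff_const)
  rw [SmoothHalf.D_eq ((SmoothHalf.of_contDiff (contDiff_weight a σ)).mul
    ((hW.smooth.D w).add (((SmoothHalf.of_contDiff hphi).mul hW.smooth).const_mul σ))) hp hl]
  ring

theorem conjOp_conj (a σ : ℝ) {W : SpT m → ℝ} (hW : Adm W) {p : SpT m} (hp : 0 < p.2) :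
    conjOp a σ (conj a σ W) p = Real.exp (σ * phi a p) * Lop W p := by
  have hy : ∀ i : Fin m, phiD a (ey i) p = 10 * p.1.1 i := fun i => by
    rw [phiD, sum_mul_single]; simp; ring
  have hz : phiD a ez p = 10 * (p.1.2 - a) := by simp [phiD]; ring
  have hs : phiD a es p = -2 * p.2 := by simp [phiD]
  have h1 : ∑ i, D (ey i) (D (ey i) (conj a σ W)) p = Real.exp (σ * phi a p) *
      (∑ i, D (ey i) (D (ey i) W) p + 20 * σ * ∑ i, p.1.1 i * D (ey i) W p
        + 10 * m * σ * W p + 100 * σ ^ 2 * (∑ i, p.1.1 i ^ 2) * W p) := by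
    have hc : 10 * m * σ * W p = ∑ _i : Fin m, 10 * σ * W p := by simp; ring
    rw [hc]
    simp only [Finset.mul_sum, Finset.sum_mul, ← Finset.sum_add_distrib]
    refine Finset.sum_congr rfl fun i _ => ?_
    rw [D_D_conj a σ hW hp, hy, sum_mul_single]
    simp
    ring
  have h2 : ∑ i, 10 * p.1.1 i * D (ey i) (conj a σ W) p = Real.exp (σ * phi a p) *
      (10 * ∑ i, p.1.1 i * D (ey i) W p + 100 * σ * (∑ i, p.1.1 i ^ 2) * W p) := by
    simp only [Finset.mul_sum, Finset.sum_mul, ← Finset.sum_add_distrib]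
    refine Finset.sum_congr rfl fun i _ => ?_
    rw [D_conj a σ hW hp, hy]
    ring
  unfold conjOp radial
  simp only [Lop]
  rw [h1, h2, D_D_conj a σ hW hp, D_D_conj a σ hW hp, D_conj a σ hW hp, D_conj a σ hW hp, hz, hs]
  unfold phiGrad distSq conj
  simp
  ring

/-- Reflection in the plane `z = 0`. -/
def refl (x : Sp m) : Sp m := (x.1, -x.2)

theorem integral_refl (f : Sp m → ℝ) : ∫ x, f (refl x) = ∫ x, f x := by
  have hmp : MeasurePreserving (refl : Sp m → Sp m) :=
    (MeasurePreserving.id (volume : Measure (EuclideanSpace ℝ (Fin m)))).prod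
      (Measure.measurePreserving_neg (volume : Measure ℝ))
  exact hmp.integral_comp ((MeasurableEquiv.refl (EuclideanSpace ℝ (Fin m))).prodCongr
    (MeasurableEquiv.neg ℝ)).measurableEmbedding f

theorem D_refl {V₁ V₂ : SpT m → ℝ} (h₁ : Adm V₁) (h₂ : Adm V₂)
    (hodd : ∀ x : Sp m, V₁ (refl x, 0) = -V₂ (x, 0)) (x v : Sp m) :
    D (v, 0) V₁ (refl x, 0) = -D (refl v, 0) V₂ (x, 0) := by
  refine h₁.smooth.D_eq_horizontal (p := (refl x, 0)) le_rfl ?_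
  have h := (h₂.smooth.hasLineDerivAt_horizontal (p := (x, 0)) le_rfl (refl v))
  unfold HasLineDerivAt at h ⊢
  refine h.neg.congr_of_eventuallyEq (Eventually.of_forall fun t => ?_)
  have := hodd (x + t • refl v)
  have e : refl (x + t • refl v) = refl x + t • v := by
    simp [refl, Prod.ext_iff, add_comm]
  rw [e] at this
  simpa using this

theorem fluxS_refl (a σ : ℝ) {V₁ V₂ : SpT m → ℝ} (h₁ : Adm V₁) (h₂ : Adm V₂)
    (hodd : ∀ x : Sp m, V₁ (refl x, 0) = -V₂ (x, 0)) (x : Sp m) :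
    fluxS a σ V₁ (refl x, 0) = -fluxS (-a) σ V₂ (x, 0) := by
  have hy : ∀ i, D (ey i) V₁ (refl x, 0) = -D (ey i) V₂ (x, 0) := fun i => by
    rw [D_refl h₁ h₂ hodd]; simp [refl]
  have hz : D ez V₁ (refl x, 0) = D ez V₂ (x, 0) := by
    rw [D_refl h₁ h₂ hodd]
    have : ((refl (0, 1) : Sp m), (0 : ℝ)) = -ez := by simp [refl]
    rw [this, D, map_neg, neg_neg, D]
  simp only [fluxS, multiplier, radial, lagr, phiGrad, distSq, hy, hz, hodd]
  simp [refl]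
  ring

theorem flux_cancel (a σ : ℝ) {V₁ V₂ : SpT m → ℝ} (h₁ : Adm V₁) (h₂ : Adm V₂)
    (hodd : ∀ x : Sp m, V₁ (refl x, 0) = -V₂ (x, 0)) :
    ∫ x : Sp m, fluxS a σ V₁ (x, 0) = -∫ x : Sp m, fluxS (-a) σ V₂ (x, 0) := by
  rw [← integral_refl, ← integral_neg]
  exact integral_congr_ae (Eventually.of_forall fun x => fluxS_refl a σ h₁ h₂ hodd x)

theorem six_le_zeroCoeff {a : ℝ} (ha : |a| = 6 / 5) {p : SpT m} (hx : normSq p.1 ≤ 1)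
    (hs : p.2 ^ 2 ≤ 5 * distSq a p.1) : 6 ≤ zeroCoeff a p := by
  have hz := abs_le.1 (abs_z_le hx)
  have hr : 1 / 25 ≤ (p.1.2 - a) ^ 2 := by
    rcases (abs_eq (by norm_num)).1 ha with h | h <;> rw [h] <;> nlinarith
  unfold distSq at hs
  unfold zeroCoeff
  have hY : 0 ≤ ∑ i, p.1.1 i ^ 2 := Finset.sum_nonneg fun i _ => sq_nonneg _
  nlinarith [sq_nonneg (675 * (p.1.2 - a) + 300 * p.2), sq_nonneg p.2]

/-- Two functions supported where the Carleman weights are under control and with odd traces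
satisfy a joint Carleman estimate with no boundary terms. -/
theorem carleman_pair {a : ℝ} (ha : a = 6 / 5) {σ : ℝ} (hσ : 10 ≤ σ) {W₁ W₂ : SpT m → ℝ}
    (h₁ : Adm W₁) (h₂ : Adm W₂)
    (hball₁ : ∀ p ∈ halfSpace (Sp m), (1 < normSq p.1 ∨ 6 < p.2) → W₁ p = 0)
    (hball₂ : ∀ p ∈ halfSpace (Sp m), (1 < normSq p.1 ∨ 6 < p.2) → W₂ p = 0)
    (hcone₁ : ∀ p ∈ halfSpace (Sp m), W₁ p ≠ 0 → p.2 ^ 2 ≤ 5 * distSq a p.1)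
    (hcone₂ : ∀ p ∈ halfSpace (Sp m), W₂ p ≠ 0 → p.2 ^ 2 ≤ 5 * distSq (-a) p.1)
    (hodd : ∀ x : Sp m, W₁ (refl x, 0) = -W₂ (x, 0)) :
    σ ^ 3 * ((∫ p in openHalf (Sp m), conj a σ W₁ p ^ 2)
        + ∫ p in openHalf (Sp m), conj (-a) σ W₂ p ^ 2)
      ≤ (∫ p in openHalf (Sp m), (Real.exp (σ * phi a p) * Lop W₁ p) ^ 2)
        + ∫ p in openHalf (Sp m), (Real.exp (σ * phi (-a) p) * Lop W₂ p) ^ 2 ∧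
    (∫ x : Sp m, (Real.exp (σ * phi a (x, 0)) * D ez W₁ (x, 0)) ^ 2)
        + ∫ x : Sp m, (Real.exp (σ * phi (-a) (x, 0)) * D ez W₂ (x, 0)) ^ 2
      ≤ (20000 + 100 * m) *
        ((∫ p in openHalf (Sp m), (Real.exp (σ * phi a p) * Lop W₁ p) ^ 2)
        + ∫ p in openHalf (Sp m), (Real.exp (σ * phi (-a) p) * Lop W₂ p) ^ 2) := by
  have ha1 : |a| = 6 / 5 := by rw [ha]; norm_num
  have ha2 : |-a| = 6 / 5 := by rw [abs_neg, ha1]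
  have hσ0 : 0 < σ := by linarith
  have key : ∀ (b : ℝ) (W : SpT m → ℝ), |b| = 6 / 5 → Adm W →
      (∀ p ∈ halfSpace (Sp m), (1 < normSq p.1 ∨ 6 < p.2) → W p = 0) →
      (∀ p ∈ halfSpace (Sp m), W p ≠ 0 → p.2 ^ 2 ≤ 5 * distSq b p.1) →
      (4 / 5 * σ * (∫ p in openHalf (Sp m), gradSq (conj b σ W) p)
        + 24 * σ ^ 3 * (∫ p in openHalf (Sp m), conj b σ W p ^ 2)
      ≤ 2 * (∫ p in openHalf (Sp m), (Real.exp (σ * phi b p) * Lop W p) ^ 2)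
        + 200 * σ ^ 2 * (∫ p in openHalf (Sp m), conj b σ W p ^ 2)
        + 4 * σ * ∫ x : Sp m, fluxS b σ (conj b σ W) (x, 0)) ∧
      ∫ x : Sp m, (Real.exp (σ * phi b (x, 0)) * D ez W (x, 0)) ^ 2 ≤
        2 * (∫ p in openHalf (Sp m), (Real.exp (σ * phi b p) * Lop W p) ^ 2)
        + (4400 + 30 * m) * (σ * (∫ p in openHalf (Sp m), gradSq (conj b σ W) p)
          + σ ^ 3 * ∫ p in openHalf (Sp m), conj b σ W p ^ 2) := by
    intro b W hb hW hball hcone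
    have hF : ∫ p in openHalf (Sp m), (Real.exp (σ * phi b p) * Lop W p) ^ 2 =
        ∫ p in openHalf (Sp m), conjOp b σ (conj b σ W) p ^ 2 :=
      setIntegral_congr_fun isOpen_openHalf.measurableSet fun p hp => by
        simp only [conjOp_conj b σ hW hp]
    rw [hF]
    refine ⟨carleman_inequality b hσ0 (adm_conj b σ hW) fun p hp h => ?_, ?_⟩
    · have hp' : p ∈ halfSpace (Sp m) := openHalf_subset hp
      have hWp : W p ≠ 0 := right_ne_zero_of_mul h
      refine six_le_zeroCoeff hb ?_ (hcone p hp' hWp)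
      by_contra hc
      exact hWp (hball p hp' (Or.inl (not_le.1 hc)))
    · have ht := trace_bound (by rw [hb]; norm_num) (by linarith : 1 ≤ σ) (adm_conj b σ hW)
        fun p hp h => by rw [conj, hball p hp h, mul_zero]
      simpa only [D_conj_trace b σ hW] using ht
  obtain ⟨k1, t1⟩ := key a W₁ ha1 h₁ hball₁ hcone₁
  obtain ⟨k2, t2⟩ := key (-a) W₂ ha2 h₂ hball₂ hcone₂
  have hflux := flux_cancel a σ (adm_conj a σ h₁) (adm_conj (-a) σ h₂) fun x => by
    have hphi : phi a (refl x, 0) = phi (-a) (x, 0) := by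
      simp [phi, distSq, refl]; ring
    simp [conj, hodd x, hphi]
  rw [hflux] at k1
  have hM1 : 0 ≤ ∫ p in openHalf (Sp m), conj a σ W₁ p ^ 2 := integral_nonneg fun _ => sq_nonneg _
  have hM2 : 0 ≤ ∫ p in openHalf (Sp m), conj (-a) σ W₂ p ^ 2 :=
    integral_nonneg fun _ => sq_nonneg _
  have hgn : ∀ (V : SpT m → ℝ) p, 0 ≤ gradSq V p := fun V p => by unfold gradSq; positivity
  have hE1 : 0 ≤ ∫ p in openHalf (Sp m), gradSq (conj a σ W₁) p := integral_nonneg (hgn _)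
  have hE2 : 0 ≤ ∫ p in openHalf (Sp m), gradSq (conj (-a) σ W₂) p := integral_nonneg (hgn _)
  generalize (∫ p in openHalf (Sp m), conj a σ W₁ p ^ 2) = M₁ at *
  generalize (∫ p in openHalf (Sp m), conj (-a) σ W₂ p ^ 2) = M₂ at *
  generalize (∫ p in openHalf (Sp m), gradSq (conj a σ W₁) p) = E₁ at *
  generalize (∫ p in openHalf (Sp m), gradSq (conj (-a) σ W₂) p) = E₂ at *
  generalize (∫ p in openHalf (Sp m), (Real.exp (σ * phi a p) * Lop W₁ p) ^ 2) = F₁ at *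
  generalize (∫ p in openHalf (Sp m), (Real.exp (σ * phi (-a) p) * Lop W₂ p) ^ 2) = F₂ at *
  have hM : 0 ≤ M₁ + M₂ := add_nonneg hM1 hM2
  have hE : 0 ≤ σ * (E₁ + E₂) := by positivity
  have hσ2 : 200 * σ ^ 2 * (M₁ + M₂) ≤ 20 * σ ^ 3 * (M₁ + M₂) :=
    mul_le_mul_of_nonneg_right (by nlinarith [sq_nonneg σ]) hM
  have hσM : 0 ≤ σ ^ 3 * (M₁ + M₂) := by positivity
  have hsum : 4 / 5 * (σ * (E₁ + E₂)) + 4 * (σ ^ 3 * (M₁ + M₂)) ≤ 2 * (F₁ + F₂) := by linarith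
  refine ⟨by linarith, ?_⟩
  have hQ : σ * (E₁ + E₂) + σ ^ 3 * (M₁ + M₂) ≤ 5 / 2 * (F₁ + F₂) := by linarith
  have hC := mul_le_mul_of_nonneg_left hQ (show (0 : ℝ) ≤ 4400 + 30 * m by positivity)
  have hF0 : 0 ≤ F₁ + F₂ := by linarith
  have hm : (0 : ℝ) ≤ m := Nat.cast_nonneg m
  linarith [mul_nonneg hm hF0]

theorem Adm.bounded {F : SpT m → ℝ} (hF : Adm F) :
    ∃ C, 0 ≤ C ∧ ∀ p ∈ halfSpace (Sp m), |F p| ≤ C := by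
  obtain ⟨R, hR⟩ := hF.supp
  have hc : IsCompact (halfSpace (Sp m) ∩ Metric.closedBall 0 R) :=
    (isCompact_closedBall 0 R).inter_left isClosed_halfSpace
  obtain ⟨C, hC⟩ := hc.exists_bound_of_continuousOn
    (hF.smooth.continuousOn.mono inter_subset_left)
  refine ⟨max C 0, le_max_right _ _, fun p hp => ?_⟩
  by_cases h : R < ‖p‖
  · rw [hR p hp h, abs_zero]; exact le_max_right _ _
  · exact (hC p ⟨hp, by simpa using not_lt.1 h⟩).trans (le_max_left _ _)

/-- A cutoff to the region `phi a > 1 / 20` over a neighbourhood of the unit ball. -/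
noncomputable def cutoff (a : ℝ) (p : SpT m) : ℝ :=
  Real.smoothTransition (20 * phi a p - 1) *
    (1 - Real.smoothTransition (100 * (normSq p.1 - 1)))

theorem contDiff_cutoff (a : ℝ) : ContDiff ℝ ∞ (cutoff a : SpT m → ℝ) := by
  have h := (contDiff_normSq (m := m)).comp (contDiff_fst (E := Sp m) (F := ℝ))
  exact (Real.smoothTransition.contDiff.comp
    ((contDiff_const.mul (contDiff_phi a)).sub contDiff_const)).mul
    (contDiff_const.sub (Real.smoothTransition.contDiff.comp
      (contDiff_const.mul (h.sub contDiff_const))))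

theorem cutoff_eq_one {a : ℝ} {p : SpT m} (h1 : 1 / 10 ≤ phi a p) (h2 : normSq p.1 ≤ 1) :
    cutoff a p = 1 := by
  rw [cutoff, Real.smoothTransition.one_of_one_le (by linarith),
    Real.smoothTransition.zero_of_nonpos (by linarith)]
  norm_num

theorem distSq_eq (a : ℝ) (x : Sp m) : distSq a x = normSq x - 2 * a * x.2 + a ^ 2 := by
  rw [distSq, normSq_eq_sum]; ring

theorem sq_le_distSq (a : ℝ) (x : Sp m) : (x.2 - a) ^ 2 ≤ distSq a x := by
  have : 0 ≤ ∑ i, x.1 i ^ 2 := Finset.sum_nonneg fun i _ => sq_nonneg _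
  unfold distSq
  linarith

theorem one_fifth_le_phi {a : ℝ} (ha : |a| = 6 / 5) {x : Sp m} (hx : normSq x ≤ 1) :
    1 / 5 ≤ phi a (x, 0) := by
  have hz := abs_le.1 (abs_z_le hx)
  have hr : 1 / 25 ≤ (x.2 - a) ^ 2 := by
    rcases (abs_eq (by norm_num)).1 ha with h | h <;> rw [h] <;> nlinarith
  have := sq_le_distSq a x
  simp only [phi]
  linarith

/-- Where the weight is positive over a neighbourhood of the ball, the time is below `6`. -/
theorem region_bounds {a : ℝ} (ha : |a| = 6 / 5) {p : SpT m} (hs : 0 ≤ p.2)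
    (h1 : 0 ≤ phi a p) (h2 : normSq p.1 ≤ 101 / 100) :
    p.2 < 5 ∧ p.1.2 + p.2 < 6 ∧ ‖p‖ ≤ 5 := by
  unfold phi at h1
  rw [distSq_eq] at h1
  have hn : ‖p.1.1‖ ^ 2 + p.1.2 ^ 2 ≤ 101 / 100 := h2
  have hz1 : p.1.2 < 1005 / 1000 := by nlinarith [sq_nonneg ‖p.1.1‖]
  have hz2 : -(1005 / 1000) < p.1.2 := by nlinarith [sq_nonneg ‖p.1.1‖]
  have haz : -(2 * a * p.1.2) ≤ 12 / 5 * (1005 / 1000) := by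
    rcases (abs_eq (by norm_num)).1 ha with h | h <;> rw [h] <;> linarith
  have ha2 : a ^ 2 = 36 / 25 := by rw [← sq_abs, ha]; norm_num
  have hs2 : p.2 < 494 / 100 := by nlinarith
  refine ⟨by linarith, by linarith, ?_⟩
  refine norm_prod_le_iff.2 ⟨norm_prod_le_iff.2 ⟨?_, ?_⟩, ?_⟩
  · nlinarith [sq_nonneg p.1.2, norm_nonneg p.1.1]
  · rw [Real.norm_eq_abs, abs_le]; constructor <;> linarith
  · rw [Real.norm_eq_abs, abs_le]; constructor <;> linarith

theorem of_cutoff_ne_zero {a : ℝ} {p : SpT m} (h : cutoff a p ≠ 0) :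
    1 / 20 < phi a p ∧ normSq p.1 < 101 / 100 := by
  constructor
  · by_contra hc
    exact h (by rw [cutoff, Real.smoothTransition.zero_of_nonpos (by linarith), zero_mul])
  · by_contra hc
    exact h (by rw [cutoff, Real.smoothTransition.one_of_one_le (x := 100 * (normSq p.1 - 1))
      (by linarith), sub_self, mul_zero])

/-- The truncated wave. -/
noncomputable def cut (a : ℝ) (U : SpT m → ℝ) (p : SpT m) : ℝ := cutoff a p * U p

section Cut

variable {a : ℝ} {U : SpT m → ℝ}

theorem adm_cut (ha : |a| = 6 / 5) (hU : SmoothHalf U) : Adm (cut a U) := by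
  refine ⟨(SmoothHalf.of_contDiff (contDiff_cutoff a)).mul hU, 5, fun p hp hR => ?_⟩
  by_contra hc
  have h := of_cutoff_ne_zero (left_ne_zero_of_mul hc)
  have := (region_bounds ha hp (by linarith [h.1]) h.2.le).2.2
  linarith

theorem cut_eq_zero (ha : |a| = 6 / 5)
    (hext : ∀ p ∈ halfSpace (Sp m), 1 ≤ normSq p.1 → p.1.2 + p.2 < 6 → U p = 0)
    {p : SpT m} (hp : p ∈ halfSpace (Sp m)) (h : 1 < normSq p.1 ∨ 6 < p.2) : cut a U p = 0 := by
  by_contra hc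
  have hr := of_cutoff_ne_zero (left_ne_zero_of_mul hc)
  have hb := region_bounds ha hp (by linarith [hr.1]) hr.2.le
  rcases h with h | h
  · exact right_ne_zero_of_mul hc (hext p hp h.le hb.2.1)
  · linarith [hb.1]

theorem cut_trace (ha : |a| = 6 / 5) (hinit : ∀ x : Sp m, 1 ≤ normSq x → U (x, 0) = 0)
    (x : Sp m) : cut a U (x, 0) = U (x, 0) := by
  by_cases h : normSq x ≤ 1
  · have hp := one_fifth_le_phi ha h
    have hc : cutoff a ((x, 0) : SpT m) = 1 :=
      cutoff_eq_one (p := (x, 0)) (le_trans (by norm_num) hp) h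
    rw [cut, hc, one_mul]
  · rw [cut, hinit x (not_le.1 h).le, mul_zero]

theorem D_cut_trace (ha : |a| = 6 / 5) (hU : SmoothHalf U)
    (hinit : ∀ x : Sp m, 1 ≤ normSq x → U (x, 0) = 0) (x : Sp m) :
    D ez (cut a U) (x, 0) = D ez U (x, 0) := by
  refine (adm_cut ha hU).smooth.D_eq_horizontal (p := (x, 0)) le_rfl ?_
  have h := hU.hasLineDerivAt_horizontal (p := (x, 0)) le_rfl ((0, 1) : Sp m)
  unfold HasLineDerivAt at h ⊢
  refine h.congr_of_eventuallyEq (Eventually.of_forall fun t => ?_)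
  simpa using cut_trace ha hinit (x + t • ((0, 1) : Sp m))

theorem Lop_congr {O : Set (SpT m)} (hO : IsOpen O) {F G : SpT m → ℝ}
    (h : ∀ p ∈ O, p ∈ halfSpace (Sp m) → F p = G p) {p : SpT m} (hp : p ∈ O)
    (hpH : p ∈ halfSpace (Sp m)) : Lop F p = Lop G p := by
  have h2 : ∀ v w, D v (D w F) p = D v (D w G) p := fun v w =>
    D_eqOn hO v (D_eqOn hO w h) p hp hpH
  simp only [Lop, h2]

theorem Lop_zero (p : SpT m) : Lop (fun _ => (0 : ℝ)) p = 0 := by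
  have h : ∀ w : SpT m, D w (fun _ : SpT m => (0 : ℝ)) = fun _ => 0 := fun w =>
    funext fun p => D_zero_fun w p
  simp [Lop, h]

theorem Lop_cut_eq_zero (ha : |a| = 6 / 5)
    (hext : ∀ p ∈ halfSpace (Sp m), 1 ≤ normSq p.1 → p.1.2 + p.2 < 6 → U p = 0)
    {p : SpT m} (hp : p ∈ halfSpace (Sp m)) (h : 1 < normSq p.1) : Lop (cut a U) p = 0 := by
  rw [Lop_congr (O := {p : SpT m | 1 < normSq p.1})
    (isOpen_lt continuous_const (contDiff_normSq.continuous.comp continuous_fst))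
    (fun q hq hqH => cut_eq_zero ha hext hqH (Or.inl hq)) h hp, Lop_zero]

theorem cut_eq (ha : |a| = 6 / 5)
    (hext : ∀ p ∈ halfSpace (Sp m), 1 ≤ normSq p.1 → p.1.2 + p.2 < 6 → U p = 0)
    {p : SpT m} (hp : p ∈ halfSpace (Sp m)) (h1 : 1 / 10 < phi a p)
    (h2 : normSq p.1 < 101 / 100) : cut a U p = U p := by
  by_cases h : normSq p.1 ≤ 1
  · rw [cut, cutoff_eq_one h1.le h, one_mul]
  · have hb := region_bounds ha hp (by linarith) h2.le
    rw [cut, hext p hp (not_le.1 h).le hb.2.1, mul_zero]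

theorem Lop_cut_eq (ha : |a| = 6 / 5)
    (hext : ∀ p ∈ halfSpace (Sp m), 1 ≤ normSq p.1 → p.1.2 + p.2 < 6 → U p = 0)
    {p : SpT m} (hp : p ∈ halfSpace (Sp m)) (h1 : 1 / 10 < phi a p)
    (h2 : normSq p.1 < 101 / 100) : Lop (cut a U) p = Lop U p :=
  Lop_congr (O := {p : SpT m | 1 / 10 < phi a p ∧ normSq p.1 < 101 / 100})
    ((isOpen_lt continuous_const (contDiff_phi a).continuous).inter
      (isOpen_lt (contDiff_normSq.continuous.comp continuous_fst) continuous_const))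
    (fun _ hq hqH => cut_eq ha hext hqH hq.1 hq.2) ⟨h1, h2⟩ hp

end Cut

theorem weight_sq (a σ : ℝ) (x : Sp m) (s : ℝ) : Real.exp (σ * phi a (x, s)) ^ 2 =
    Real.exp (σ * phi a (x, 0)) ^ 2 * Real.exp (-(2 * σ) * s ^ 2) := by
  rw [← Real.exp_nat_mul, ← Real.exp_nat_mul, ← Real.exp_add]
  congr 1
  simp only [phi]
  push_cast
  ring

theorem source_bound {a : ℝ} (ha : |a| = 6 / 5) {U U₂ : SpT m → ℝ} (hU : SmoothHalf U)
    (hU₂ : SmoothHalf U₂) {q q₁ : Sp m → ℝ} (hq : Continuous q) (hq₁ : Continuous q₁)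
    (hsupp : ∀ x, 1 < normSq x → q x = 0)
    (hL : ∀ p : SpT m, 0 < p.2 → Lop U p = q₁ p.1 * U p + q p.1 * U₂ p)
    (hext : ∀ p ∈ halfSpace (Sp m), 1 ≤ normSq p.1 → p.1.2 + p.2 < 6 → U p = 0) :
    ∃ C, 0 ≤ C ∧ ∀ σ : ℝ, 1 ≤ σ →
      ∫ p in openHalf (Sp m), (Real.exp (σ * phi a p) * Lop (cut a U) p) ^ 2 ≤
        C * ((∫ p in openHalf (Sp m), conj a σ (cut a U) p ^ 2)
          + √(Real.pi / (2 * σ)) / 2 * (∫ x : Sp m, (Real.exp (σ * phi a (x, 0)) * q x) ^ 2)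
          + Real.exp (σ / 5)) := by
  have hA := adm_cut ha hU
  obtain ⟨CL, hCL0, hCL⟩ := (adm_Lop hA).bounded
  set K : Set (SpT m) := Metric.closedBall 0 5 with hK
  have hKc : IsCompact (halfSpace (Sp m) ∩ K) :=
    (isCompact_closedBall 0 5).inter_left isClosed_halfSpace
  obtain ⟨C1, hC1⟩ := hKc.exists_bound_of_continuousOn (f := fun p : SpT m => q₁ p.1)
    (hq₁.comp continuous_fst).continuousOn
  obtain ⟨C2, hC2⟩ := hKc.exists_bound_of_continuousOn (hU₂.continuousOn.mono inter_subset_left)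
  set κ := (volume.restrict (openHalf (Sp m))).real K with hκ
  have hκ0 : 0 ≤ κ := measureReal_nonneg
  refine ⟨2 * C1 ^ 2 + 2 * C2 ^ 2 + CL ^ 2 * κ, by positivity, fun σ hσ => ?_⟩
  have hσ0 : 0 < σ := by linarith
  have hpt : ∀ p ∈ openHalf (Sp m), (Real.exp (σ * phi a p) * Lop (cut a U) p) ^ 2 ≤
      2 * C1 ^ 2 * conj a σ (cut a U) p ^ 2
        + 2 * C2 ^ 2 * ((Real.exp (σ * phi a (p.1, 0)) * q p.1) ^ 2
            * Real.exp (-(2 * σ) * p.2 ^ 2))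
        + K.indicator (fun _ => CL ^ 2 * Real.exp (σ / 5)) p := by
    intro p hp
    have hpH : p ∈ halfSpace (Sp m) := openHalf_subset hp
    have hind : 0 ≤ K.indicator (fun _ => CL ^ 2 * Real.exp (σ / 5)) p :=
      indicator_nonneg (fun _ _ => by positivity) p
    by_cases hout : 1 < normSq p.1
    · rw [Lop_cut_eq_zero ha hext hpH hout, mul_zero, zero_pow two_ne_zero]
      positivity
    have hin : normSq p.1 ≤ 1 := not_lt.1 hout
    by_cases hphi : 1 / 10 < phi a p
    · have hb := region_bounds ha hpH (by linarith) (by linarith)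
      have hpK : p ∈ halfSpace (Sp m) ∩ K := ⟨hpH, by simpa [hK] using hb.2.2⟩
      have h1 : |q₁ p.1| ≤ C1 := hC1 p hpK
      have h2 : |U₂ p| ≤ C2 := hC2 p hpK
      have h1' : q₁ p.1 ^ 2 ≤ C1 ^ 2 := sq_le_sq' (abs_le.1 h1).1 (abs_le.1 h1).2
      have h2' : U₂ p ^ 2 ≤ C2 ^ 2 := sq_le_sq' (abs_le.1 h2).1 (abs_le.1 h2).2
      rw [Lop_cut_eq ha hext hpH hphi (by linarith), hL p hp]
      have hc : conj a σ (cut a U) p = Real.exp (σ * phi a p) * U p := by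
        rw [conj, cut_eq ha hext hpH hphi (by linarith)]
      have hw := weight_sq a σ p.1 p.2
      have e2 : (Real.exp (σ * phi a (p.1, 0)) * q p.1) ^ 2 * Real.exp (-(2 * σ) * p.2 ^ 2) =
          (Real.exp (σ * phi a p) * q p.1) ^ 2 := by
        rw [mul_pow, mul_pow, hw]; ring
      rw [hc, e2]
      set w := Real.exp (σ * phi a p)
      have k1 := mul_le_mul_of_nonneg_right h1' (sq_nonneg (w * U p))
      have k2 := mul_le_mul_of_nonneg_right h2' (sq_nonneg (w * q p.1))
      nlinarith [sq_nonneg (w * (q₁ p.1 * U p - q p.1 * U₂ p))]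
    · by_cases hpK : p ∈ K
      · rw [indicator_of_mem hpK]
        have h1 := hCL p hpH
        have h2 : Lop (cut a U) p ^ 2 ≤ CL ^ 2 := sq_le_sq' (abs_le.1 h1).1 (abs_le.1 h1).2
        have h3 : Real.exp (σ * phi a p) ^ 2 ≤ Real.exp (σ / 5) := by
          rw [← Real.exp_nat_mul]
          refine Real.exp_le_exp.2 ?_
          push_cast
          nlinarith [not_lt.1 hphi]
        have h4 : (Real.exp (σ * phi a p) * Lop (cut a U) p) ^ 2 ≤ CL ^ 2 * Real.exp (σ / 5) := by
          rw [mul_pow, mul_comm]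
          exact mul_le_mul h2 h3 (by positivity) (by positivity)
        have h5 : 0 ≤ 2 * C1 ^ 2 * conj a σ (cut a U) p ^ 2
          + 2 * C2 ^ 2 * ((Real.exp (σ * phi a (p.1, 0)) * q p.1) ^ 2
            * Real.exp (-(2 * σ) * p.2 ^ 2)) := by positivity
        linarith
      · have hz : Lop (cut a U) p = 0 := by
          rw [Lop_congr (O := Kᶜ) Metric.isClosed_closedBall.isOpen_compl (G := fun _ => 0)
            (fun r hr hrH => ?_) hpK hpH, Lop_zero]
          by_contra hcc
          have hr2 := of_cutoff_ne_zero (left_ne_zero_of_mul hcc)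
          exact hr (by simpa [hK] using (region_bounds ha hrH (by linarith [hr2.1]) hr2.2.le).2.2)
        rw [hz, mul_zero, zero_pow two_ne_zero]
        positivity
  have hqc : HasCompactSupport (fun x : Sp m => (Real.exp (σ * phi a (x, 0)) * q x) ^ 2) := by
    refine HasCompactSupport.intro (isCompact_closedBall (0 : Sp m) 1) fun x hx => ?_
    rw [hsupp x, mul_zero, zero_pow two_ne_zero]
    by_contra hc
    refine hx ?_
    have hn : ‖x.1‖ ^ 2 + x.2 ^ 2 ≤ 1 := not_lt.1 hc
    rw [mem_closedBall_zero_iff]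
    exact norm_prod_le_iff.2 ⟨by nlinarith [sq_nonneg x.2, norm_nonneg x.1], abs_z_le hn⟩
  have hqi : Integrable (fun x : Sp m => (Real.exp (σ * phi a (x, 0)) * q x) ^ 2) := by
    refine Continuous.integrable_of_hasCompactSupport ?_ hqc
    have h1 : Continuous (fun x : Sp m => phi a (x, 0)) :=
      (contDiff_phi a).continuous.comp (by fun_prop)
    fun_prop
  have hgi : Integrable (fun s : ℝ => Real.exp (-(2 * σ) * s ^ 2)) (volume.restrict (Ioi 0)) :=
    (integrable_exp_neg_mul_sq (by linarith : 0 < 2 * σ)).integrableOn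
  have hprod : IntegrableOn (fun p : SpT m => (Real.exp (σ * phi a (p.1, 0)) * q p.1) ^ 2
      * Real.exp (-(2 * σ) * p.2 ^ 2)) (openHalf (Sp m)) := by
    rw [IntegrableOn, restrict_openHalf]
    exact hqi.mul_prod hgi
  have hprodI : ∫ p in openHalf (Sp m), (Real.exp (σ * phi a (p.1, 0)) * q p.1) ^ 2
      * Real.exp (-(2 * σ) * p.2 ^ 2) =
      √(Real.pi / (2 * σ)) / 2 * ∫ x : Sp m, (Real.exp (σ * phi a (x, 0)) * q x) ^ 2 := by
    rw [restrict_openHalf, integral_prod_mul (fun x : Sp m => (Real.exp (σ * phi a (x, 0)) * q x) ^ 2)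
      (fun s : ℝ => Real.exp (-(2 * σ) * s ^ 2)), integral_gaussian_Ioi, mul_comm]
  have hKfin : (volume.restrict (openHalf (Sp m))) K ≠ ⊤ :=
    ((Measure.restrict_apply_le _ _).trans_lt (isCompact_closedBall 0 5).measure_lt_top).ne
  have hindi : IntegrableOn (K.indicator (fun _ => CL ^ 2 * Real.exp (σ / 5)))
      (openHalf (Sp m)) :=
    (integrable_indicator_iff Metric.isClosed_closedBall.measurableSet).2
      (integrableOn_const hKfin)
  have hindI : ∫ p in openHalf (Sp m), K.indicator (fun _ => CL ^ 2 * Real.exp (σ / 5)) p =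
      κ * (CL ^ 2 * Real.exp (σ / 5)) := by
    rw [integral_indicator_const _ Metric.isClosed_closedBall.measurableSet, smul_eq_mul]
  have hFi : IntegrableOn (fun p => (Real.exp (σ * phi a p) * Lop (cut a U) p) ^ 2)
      (openHalf (Sp m)) :=
    (Adm.mul_left (SmoothHalf.of_contDiff (contDiff_weight a σ)) (adm_Lop hA)).sq.integrableOn
  have hMi : IntegrableOn (fun p => 2 * C1 ^ 2 * conj a σ (cut a U) p ^ 2) (openHalf (Sp m)) :=
    ((adm_conj a σ hA).sq.const_mul _).integrableOn
  have hPi := hprod.const_mul (2 * C2 ^ 2)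
  have hle := setIntegral_mono_on hFi ((hMi.add hPi).add hindi) isOpen_openHalf.measurableSet hpt
  rw [integral_add' (hMi.add hPi) hindi, integral_add' hMi hPi, integral_const_mul,
    integral_const_mul, hprodI, hindI] at hle
  refine hle.trans ?_
  have hM0 : 0 ≤ ∫ p in openHalf (Sp m), conj a σ (cut a U) p ^ 2 :=
    integral_nonneg fun _ => sq_nonneg _
  have hI0 : 0 ≤ √(Real.pi / (2 * σ)) / 2 * ∫ x : Sp m, (Real.exp (σ * phi a (x, 0)) * q x) ^ 2 :=
    mul_nonneg (by positivity) (integral_nonneg fun _ => sq_nonneg _)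
  have hE0 := (Real.exp_pos (σ / 5)).le
  generalize (∫ p in openHalf (Sp m), conj a σ (cut a U) p ^ 2) = M at *
  generalize (√(Real.pi / (2 * σ)) / 2 * ∫ x : Sp m, (Real.exp (σ * phi a (x, 0)) * q x) ^ 2) = I
    at *
  generalize Real.exp (σ / 5) = e at *
  nlinarith [mul_nonneg (sq_nonneg C1) hI0, mul_nonneg (sq_nonneg C1) hE0,
    mul_nonneg (sq_nonneg C2) hM0, mul_nonneg (sq_nonneg C2) hE0,
    mul_nonneg (mul_nonneg (sq_nonneg CL) hκ0) hM0, mul_nonneg (mul_nonneg (sq_nonneg CL) hκ0) hI0]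

theorem hasCompactSupport_of_normSq {f : Sp m → ℝ} (hf : ∀ x, 1 < normSq x → f x = 0) :
    HasCompactSupport f := by
  refine HasCompactSupport.of_support_subset_isCompact (isCompact_closedBall (0 : Sp m) 1) ?_
  intro x hx
  have h : normSq x ≤ 1 := not_lt.1 fun h => hx (hf x h)
  rw [mem_closedBall_zero_iff, Prod.norm_def]
  refine max_le ?_ ?_
  · refine abs_le_one_iff_mul_self_le_one.2 ?_ |> le_trans (le_abs_self _)
    unfold normSq at h
    nlinarith [sq_nonneg x.2]
  · exact abs_z_le h

theorem exp_mul_integral_sq_le {a : ℝ} (ha : |a| = 6 / 5) {q : Sp m → ℝ} (hq : Continuous q)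
    (hsupp : ∀ x, 1 < normSq x → q x = 0) {σ : ℝ} (hσ : 0 ≤ σ) :
    Real.exp (σ * (2 / 5)) * ∫ x, q x ^ 2 ≤
      ∫ x : Sp m, (Real.exp (σ * phi a (x, 0)) * q x) ^ 2 := by
  rw [← integral_const_mul]
  have hcs : ∀ g : Sp m → ℝ, Continuous g → Integrable fun x => (g x * q x) ^ 2 := by
    intro g hg
    refine Continuous.integrable_of_hasCompactSupport (by fun_prop) ?_
    exact hasCompactSupport_of_normSq fun x hx => by rw [hsupp x hx]; simp
  have hphi : Continuous fun x : Sp m => phi a (x, 0) :=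
    (contDiff_phi a).continuous.comp (by fun_prop : Continuous fun x : Sp m => ((x, 0) : SpT m))
  have hi : Integrable fun x => Real.exp (σ * (2 / 5)) * q x ^ 2 := by
    simpa using (hcs (fun _ => 1) continuous_const).const_mul (Real.exp (σ * (2 / 5)))
  refine integral_mono hi (hcs _ (by fun_prop)) fun x => ?_
  · rcases le_or_gt (normSq x) 1 with h | h
    · have h1 := one_fifth_le_phi ha h
      have h2 : Real.exp (σ * (2 / 5)) ≤ Real.exp (σ * phi a (x, 0)) ^ 2 := by
        rw [← Real.exp_nat_mul]
        refine Real.exp_le_exp.2 ?_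
        push_cast
        nlinarith
      simp only [mul_pow]
      exact mul_le_mul_of_nonneg_right h2 (sq_nonneg _)
    · simp [hsupp x h]

theorem eq_zero_of_integral_sq_le {q : Sp m → ℝ} (hq : Continuous q)
    (hsupp : ∀ x, 1 < normSq x → q x = 0) (h : ∫ x, q x ^ 2 ≤ 0) (x : Sp m) : q x = 0 := by
  have hi : Integrable fun x => q x ^ 2 :=
    Continuous.integrable_of_hasCompactSupport (by fun_prop)
      (hasCompactSupport_of_normSq fun x hx => by rw [hsupp x hx]; simp)
  have h0 : ∫ x, q x ^ 2 = 0 := le_antisymm h (integral_nonneg fun x => sq_nonneg _)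
  have h1 := (integral_eq_zero_iff_of_nonneg (fun x => sq_nonneg (q x)) hi).1 h0
  have h2 := (Continuous.ae_eq_iff_eq volume (by fun_prop : Continuous fun x => q x ^ 2)
    continuous_const).1 h1
  exact pow_eq_zero_iff (two_ne_zero) |>.1 (congrFun h2 x)

theorem absorb {F M I E C N σ κ : ℝ} (hF : 0 ≤ F) (hC : 0 ≤ C)
    (hκ : 0 ≤ κ) (hσ : 0 < σ) (h1 : σ ^ 3 * M ≤ F) (h2 : I / 4 ≤ N * F)
    (h3 : F ≤ C * (M + κ * I + 2 * E)) (hs1 : 4 * C ≤ σ ^ 3) (hs2 : 16 * (N * C * κ) ≤ 1) :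
    F ≤ 4 * C * E := by
  have hM : C * M ≤ F / 4 := by
    have h3 : 0 < σ ^ 3 := by positivity
    have hM' : M ≤ F / σ ^ 3 := by rw [le_div_iff₀ h3]; linarith
    calc C * M ≤ C * (F / σ ^ 3) := by gcongr
      _ = (C / σ ^ 3) * F := by ring
      _ ≤ (1 / 4) * F := by
        refine mul_le_mul_of_nonneg_right ?_ hF
        rw [div_le_iff₀ h3]; linarith
      _ = F / 4 := by ring
  have hI : C * (κ * I) ≤ F / 4 := by
    calc C * (κ * I) = (C * κ) * I := by ring
      _ ≤ (C * κ) * (4 * (N * F)) := by gcongr; linarith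
      _ = (16 * (N * C * κ)) * (F / 4) := by ring
      _ ≤ 1 * (F / 4) := by gcongr
      _ = F / 4 := one_mul _
  linarith

theorem halfspace_uniqueness {U U₂ : SpT m → ℝ} (hU : SmoothHalf U)
    (hU₂ : SmoothHalf U₂) {q q₁ : Sp m → ℝ} (hq : Continuous q) (hq₁ : Continuous q₁)
    (hsupp : ∀ x, 1 < normSq x → q x = 0)
    (hL : ∀ p : SpT m, 0 < p.2 → Lop U p = q₁ p.1 * U p + q p.1 * U₂ p)
    (hext : ∀ p ∈ halfSpace (Sp m), 1 ≤ normSq p.1 → p.1.2 + p.2 < 6 → U p = 0)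
    (hinit : ∀ x : Sp m, 1 ≤ normSq x → U (x, 0) = 0)
    (hodd : ∀ x : Sp m, U (refl x, 0) = -U (x, 0))
    (htrace : ∀ x : Sp m, D ez U (x, 0) = -(1 / 2) * q x) (x : Sp m) : q x = 0 := by
  have ha : |(6 / 5 : ℝ)| = 6 / 5 := by norm_num
  have hb : |(-(6 / 5) : ℝ)| = 6 / 5 := by norm_num
  obtain ⟨C₁, hC₁, hS₁⟩ := source_bound ha hU hU₂ hq hq₁ hsupp hL hext
  obtain ⟨C₂, hC₂, hS₂⟩ := source_bound hb hU hU₂ hq hq₁ hsupp hL hext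
  have hcone : ∀ a : ℝ, ∀ p ∈ halfSpace (Sp m), cut a U p ≠ 0 → p.2 ^ 2 ≤ 5 * distSq a p.1 := by
    intro a p _ hne
    have h := (of_cutoff_ne_zero (left_ne_zero_of_mul hne)).1
    simp only [phi] at h
    linarith
  set C := C₁ + C₂ with hCdef
  set N : ℝ := 20000 + 100 * m with hN
  have hκ : Tendsto (fun σ : ℝ => 16 * (N * C * (√(Real.pi / (2 * σ)) / 2))) atTop (𝓝 0) := by
    have h1 : Tendsto (fun σ : ℝ => Real.pi / (2 * σ)) atTop (𝓝 0) :=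
      Tendsto.const_div_atTop (tendsto_id.const_mul_atTop two_pos) _
    have h2 := (Real.continuous_sqrt.tendsto 0).comp h1
    have h3 := ((h2.div_const 2).const_mul (N * C)).const_mul 16
    simpa using h3
  have hpow : Tendsto (fun σ : ℝ => σ ^ 3) atTop atTop := tendsto_pow_atTop (by norm_num)
  have hlim : Tendsto (fun σ : ℝ => 8 * N * C * Real.exp (-(σ / 5))) atTop (𝓝 0) := by
    have h1 : Tendsto (fun σ : ℝ => σ / 5) atTop atTop := tendsto_id.atTop_div_const (by norm_num)
    simpa using ((Real.tendsto_exp_neg_atTop_nhds_zero.comp h1).const_mul (8 * N * C))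
  refine eq_zero_of_integral_sq_le hq hsupp (ge_of_tendsto hlim ?_) x
  filter_upwards [eventually_ge_atTop 10, hpow.eventually_ge_atTop (4 * C),
    hκ.eventually_le_const one_pos] with σ hσ hs1 hs2
  have hσ0 : 0 < σ := by linarith
  have hpair := carleman_pair rfl hσ (adm_cut ha hU) (adm_cut hb hU)
    (fun p hp h => cut_eq_zero ha hext hp h) (fun p hp h => cut_eq_zero hb hext hp h)
    (hcone _) (hcone _)
    (fun x => by rw [cut_trace ha hinit, cut_trace hb hinit, hodd])
  have hT : ∀ a : ℝ, |a| = 6 / 5 →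
      ∫ x : Sp m, (Real.exp (σ * phi a (x, 0)) * D ez (cut a U) (x, 0)) ^ 2 =
        (∫ x : Sp m, (Real.exp (σ * phi a (x, 0)) * q x) ^ 2) / 4 := by
    intro a ha
    rw [← integral_div]
    congr 1 with x
    rw [D_cut_trace ha hU hinit, htrace]
    ring
  rw [hT _ ha, hT _ hb] at hpair
  have hE₁ := exp_mul_integral_sq_le ha hq hsupp hσ0.le
  have hE₂ := exp_mul_integral_sq_le hb hq hsupp hσ0.le
  have hS₁ := hS₁ σ (by linarith)
  have hS₂ := hS₂ σ (by linarith)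
  have hnn : ∀ (μ : Measure (SpT m)) (f : SpT m → ℝ), 0 ≤ ∫ p, f p ^ 2 ∂μ := fun μ f =>
    integral_nonneg fun p => sq_nonneg _
  have hnnx : ∀ (f : Sp m → ℝ), 0 ≤ ∫ p, f p ^ 2 := fun f => integral_nonneg fun p => sq_nonneg _
  have hF₁ := hnn (volume.restrict (openHalf (Sp m)))
    fun p => Real.exp (σ * phi (6 / 5) p) * Lop (cut (6 / 5) U) p
  have hF₂ := hnn (volume.restrict (openHalf (Sp m)))
    fun p => Real.exp (σ * phi (-(6 / 5)) p) * Lop (cut (-(6 / 5)) U) p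
  have hM₁ := hnn (volume.restrict (openHalf (Sp m))) (conj (6 / 5) σ (cut (6 / 5) U))
  have hM₂ := hnn (volume.restrict (openHalf (Sp m))) (conj (-(6 / 5)) σ (cut (-(6 / 5)) U))
  have hI₁ := hnnx fun x => Real.exp (σ * phi (6 / 5) (x, 0)) * q x
  have hI₂ := hnnx fun x => Real.exp (σ * phi (-(6 / 5)) (x, 0)) * q x
  have hκ0 : 0 ≤ √(Real.pi / (2 * σ)) / 2 := by positivity
  have hE0 := (Real.exp_pos (σ / 5)).le
  generalize (∫ p in openHalf (Sp m),
    (Real.exp (σ * phi (6 / 5) p) * Lop (cut (6 / 5) U) p) ^ 2) = F₁ at *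
  generalize (∫ p in openHalf (Sp m),
    (Real.exp (σ * phi (-(6 / 5)) p) * Lop (cut (-(6 / 5)) U) p) ^ 2) = F₂ at *
  generalize (∫ p in openHalf (Sp m), conj (6 / 5) σ (cut (6 / 5) U) p ^ 2) = M₁ at *
  generalize (∫ p in openHalf (Sp m), conj (-(6 / 5)) σ (cut (-(6 / 5)) U) p ^ 2) = M₂ at *
  generalize (∫ x : Sp m, (Real.exp (σ * phi (6 / 5) (x, 0)) * q x) ^ 2) = I₁ at *
  generalize (∫ x : Sp m, (Real.exp (σ * phi (-(6 / 5)) (x, 0)) * q x) ^ 2) = I₂ at *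
  generalize (∫ x : Sp m, q x ^ 2) = J at *
  generalize √(Real.pi / (2 * σ)) / 2 = κ at *
  have hexp : Real.exp (σ * (2 / 5)) = Real.exp (σ / 5) * Real.exp (σ / 5) := by
    rw [← Real.exp_add]; ring_nf
  have hF : F₁ + F₂ ≤ C * ((M₁ + M₂) + κ * (I₁ + I₂) + 2 * Real.exp (σ / 5)) := by
    have h1 : 0 ≤ M₁ + κ * I₁ + Real.exp (σ / 5) := by positivity
    have h2 : 0 ≤ M₂ + κ * I₂ + Real.exp (σ / 5) := by positivity
    have h3 := mul_nonneg hC₂ h1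
    have h4 := mul_nonneg hC₁ h2
    rw [hCdef]
    linarith
  have hC : 0 ≤ C := add_nonneg hC₁ hC₂
  have hN0 : 0 ≤ N := by positivity
  have hab := absorb (add_nonneg hF₁ hF₂) hC hκ0 hσ0 hpair.1
    (by linarith [hpair.2] : (I₁ + I₂) / 4 ≤ N * (F₁ + F₂)) hF hs1 hs2
  have hfin : 2 * (Real.exp (σ / 5) * Real.exp (σ / 5)) * J ≤
      4 * (N * (4 * C * Real.exp (σ / 5))) := by
    have := mul_le_mul_of_nonneg_left hab hN0
    rw [hexp] at hE₁ hE₂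
    linarith [hpair.2]
  rw [Real.exp_neg, ← div_eq_mul_inv, le_div_iff₀ (Real.exp_pos _)]
  refine le_of_mul_le_mul_left ?_ (Real.exp_pos (σ / 5))
  linarith

theorem SmoothHalf.D_sub {U V : SpT m → ℝ} (hU : SmoothHalf U) (hV : SmoothHalf V) {p : SpT m}
    (hp : 0 < p.2) (v : SpT m) :
    FixedAngle.D v (fun p => U p - V p) p = FixedAngle.D v U p - FixedAngle.D v V p :=
  (hU.sub hV).D_eq hp (lineDeriv_sub (hU.hasLineDerivAt hp v) (hV.hasLineDerivAt hp v))

theorem SmoothHalf.D_D_sub {U V : SpT m → ℝ} (hU : SmoothHalf U) (hV : SmoothHalf V) {p : SpT m}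
    (hp : 0 < p.2) (v w : SpT m) :
    FixedAngle.D v (FixedAngle.D w (fun p => U p - V p)) p =
      FixedAngle.D v (FixedAngle.D w U) p - FixedAngle.D v (FixedAngle.D w V) p := by
  rw [← (hU.D w).D_sub (hV.D w) hp v]
  exact D_eqOn isOpen_openHalf v (fun p hp _ => hU.D_sub hV hp w) p hp
    (openHalf_subset hp)

theorem Lop_sub {U V : SpT m → ℝ} (hU : SmoothHalf U) (hV : SmoothHalf V) {p : SpT m}
    (hp : 0 < p.2) : Lop (fun p => U p - V p) p = Lop U p - Lop V p := by
  simp only [Lop, hU.D_D_sub hV hp, Finset.sum_sub_distrib]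
  ring

/-- The function `u` in the coordinates `((y, z), s)`, `s = t - z`. -/
def shift (u : SpT m → ℝ) (p : SpT m) : ℝ := u (p.1, p.1.2 + p.2)

theorem smoothHalf_shift {u : SpT m → ℝ} (hu : ContDiffOn ℝ ∞ u {p | p.1.2 ≤ p.2}) :
    SmoothHalf (shift u) := by
  refine ContDiffOn.comp (g := u) hu
    (f := fun p : SpT m => (p.1, p.1.2 + p.2)) (ContDiff.contDiffOn (by fun_prop)) ?_
  intro p hp
  have : 0 ≤ p.2 := hp
  simpa using this

theorem dir2_shift {u : SpT m → ℝ} (hu : SmoothHalf (shift u)) {p : SpT m} (hp : 0 < p.2)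
    (v : SpT m) : dir2 u (p.1, p.1.2 + p.2) (v.1, v.1.2 + v.2) = D v (D v (shift u)) p := by
  rw [← hu.dir2_eq hp v, dir2]
  congr 1 with r
  rw [shift]
  congr 1
  ext1
  · rfl
  · simp only [Prod.snd_add, Prod.fst_add, Prod.smul_snd, Prod.smul_fst, smul_eq_mul]
    ring

theorem waveOp_shift {u : SpT m → ℝ} (hu : SmoothHalf (shift u)) {p : SpT m} (hp : 0 < p.2) :
    waveOp m u (p.1, p.1.2 + p.2) = -Lop (shift u) p := by
  have ht := dir2_shift hu hp es
  have hy : ∀ i, dir2 u (p.1, p.1.2 + p.2) (ey i) = _ := fun i => by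
    simpa using dir2_shift hu hp (ey i)
  have hz := dir2_shift hu hp (ez - es)
  have hD : D (ez - es) (shift u) = fun p => D ez (shift u) p - D es (shift u) p :=
    funext fun p => D_sub_dir _ _ _ _
  rw [hD, (hu.D ez).D_sub (hu.D es) hp, D_sub_dir, D_sub_dir, hu.D_comm hp es ez] at hz
  simp only [Prod.fst_sub, Prod.snd_sub, Prod.snd_zero, sub_zero, zero_add,
    zero_sub, add_neg_cancel] at ht hz
  rw [waveOp, ht, hz]
  simp only [hy, Lop]
  ring

theorem integral_Iic_add_neg {f : ℝ → ℝ} (hf : Integrable f) (heven : ∀ s, f s = f (-s)) (z : ℝ) :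
    (∫ s in Iic z, f s) + ∫ s in Iic (-z), f s = ∫ s, f s := by
  rw [← intervalIntegral.integral_Iic_add_Ioi (b := z) hf.integrableOn hf.integrableOn]
  congr 1
  simpa only [← heven, neg_neg] using integral_comp_neg_Iic (-z) f

/-- The antiderivative of an even function supported in `{s : c + s² ≤ 1}` which vanishes at
the end points of this interval is odd and vanishes off the interval. -/
theorem antideriv_vanishing {f : ℝ → ℝ} {c : ℝ} (hf : Integrable f) (heven : ∀ s, f s = f (-s))
    (hsupp : ∀ s, 1 < c + s ^ 2 → f s = 0) (hdata : ∀ z, c + z ^ 2 = 1 → ∫ s in Iic z, f s = 0) :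
    (∀ z, 1 ≤ c + z ^ 2 → ∫ s in Iic z, f s = 0) ∧
      ∀ z, ∫ s in Iic (-z), f s = -∫ s in Iic z, f s := by
  have htot : ∫ s, f s = 0 := by
    rcases le_or_gt c 1 with h | h
    · have h1 : c + √(1 - c) ^ 2 = 1 := by rw [Real.sq_sqrt (by linarith)]; ring
      rw [← integral_Iic_add_neg hf heven √(1 - c), hdata _ h1, hdata _ (by rwa [neg_sq]), add_zero]
    · rw [integral_eq_zero_of_ae]
      exact Eventually.of_forall fun s => hsupp s (by nlinarith [sq_nonneg s])
  have hodd : ∀ z, ∫ s in Iic (-z), f s = -∫ s in Iic z, f s := fun z => by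
    linarith [integral_Iic_add_neg hf heven z]
  have hneg : ∀ z ≤ 0, 1 ≤ c + z ^ 2 → ∫ s in Iic z, f s = 0 := by
    intro z hz h
    rw [integral_Iic_eq_integral_Iio]
    refine setIntegral_eq_zero_of_forall_eq_zero fun s hs => hsupp s ?_
    have hs' : s < z := hs
    nlinarith
  refine ⟨fun z h => ?_, hodd⟩
  rcases le_total z 0 with hz | hz
  · exact hneg z hz h
  · have := hneg (-z) (by linarith) (by rwa [neg_sq])
    linarith [hodd z]

theorem hasDerivAt_integral_Iic {f : ℝ → ℝ} (hf : Integrable f) (hc : Continuous f) (z : ℝ) :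
    HasDerivAt (fun z => ∫ s in Iic z, f s) (f z) z := by
  have h := (intervalIntegral.integral_hasDerivAt_right (hc.intervalIntegrable 0 z)
    (hc.stronglyMeasurableAtFilter _ _) hc.continuousAt).add_const (∫ s in Iic 0, f s)
  refine h.congr_of_eventuallyEq (Eventually.of_forall fun w => ?_)
  simp only
  rw [← intervalIntegral.integral_Iic_sub_Iic hf.integrableOn hf.integrableOn]
  ring

theorem integrable_slice {q : Sp m → ℝ} (hq : Continuous q) (hsupp : ∀ x, 1 < normSq x → q x = 0)
    (y : EuclideanSpace ℝ (Fin m)) : Integrable fun s => q (y, s) := by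
  refine Continuous.integrable_of_hasCompactSupport (by fun_prop) ?_
  refine HasCompactSupport.of_support_subset_isCompact (isCompact_closedBall (0 : ℝ) 1) ?_
  intro s hs
  have h : normSq (y, s) ≤ 1 := not_lt.1 fun h => hs (hsupp _ h)
  rw [mem_closedBall_zero_iff]
  exact abs_z_le h

end FixedAngle

open FixedAngle
/-- Corollary 1.3 (uniqueness part, fixed angle scattering for symmetric potentials):
two smooth potentials supported in the closed unit ball, both even in the last variable,
whose scattered plane waves (incoming direction `e`) agree on `Σ_l` with `T > 6`,
must coincide. -/
theorem fixed_angle_symmetric_uniqueness (m : ℕ) (hm : 1 ≤ m) (T : ℝ) (hT : 6 < T)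
    (q₁ q₂ : EuclideanSpace ℝ (Fin m) × ℝ → ℝ)
    (hq₁ : ContDiff ℝ (⊤ : ℕ∞) q₁) (hq₂ : ContDiff ℝ (⊤ : ℕ∞) q₂)
    (hq₁supp : ∀ y : EuclideanSpace ℝ (Fin m), ∀ z : ℝ, 1 < ‖y‖ ^ 2 + z ^ 2 → q₁ (y, z) = 0)
    (hq₂supp : ∀ y : EuclideanSpace ℝ (Fin m), ∀ z : ℝ, 1 < ‖y‖ ^ 2 + z ^ 2 → q₂ (y, z) = 0)
    (hq₁even : ∀ y : EuclideanSpace ℝ (Fin m), ∀ z : ℝ, q₁ (y, z) = q₁ (y, -z))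
    (hq₂even : ∀ y : EuclideanSpace ℝ (Fin m), ∀ z : ℝ, q₂ (y, z) = q₂ (y, -z))
    (u₁ u₂ : (EuclideanSpace ℝ (Fin m) × ℝ) × ℝ → ℝ)
    (hu₁_smooth : ContDiffOn ℝ (⊤ : ℕ∞) u₁ {p | p.1.2 ≤ p.2})
    (hu₂_smooth : ContDiffOn ℝ (⊤ : ℕ∞) u₂ {p | p.1.2 ≤ p.2})
    (hu₁_pde : ∀ p : (EuclideanSpace ℝ (Fin m) × ℝ) × ℝ, p.1.2 < p.2 →
      waveOp m u₁ p + q₁ p.1 * u₁ p = 0)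
    (hu₂_pde : ∀ p : (EuclideanSpace ℝ (Fin m) × ℝ) × ℝ, p.1.2 < p.2 →
      waveOp m u₂ p + q₂ p.1 * u₂ p = 0)
    (hu₁_char : ∀ y : EuclideanSpace ℝ (Fin m), ∀ z : ℝ,
      u₁ ((y, z), z) = -(1 / 2) * ∫ s in Set.Iic z, q₁ (y, s))
    (hu₂_char : ∀ y : EuclideanSpace ℝ (Fin m), ∀ z : ℝ,
      u₂ ((y, z), z) = -(1 / 2) * ∫ s in Set.Iic z, q₂ (y, s))
    (hu₁_ic : ∀ y : EuclideanSpace ℝ (Fin m), ∀ z t : ℝ, z ≤ t → t < -1 →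
      u₁ ((y, z), t) = 0)
    (hu₂_ic : ∀ y : EuclideanSpace ℝ (Fin m), ∀ z t : ℝ, z ≤ t → t < -1 →
      u₂ ((y, z), t) = 0)
    -- the data agree on Σ_l
    (hdata : ∀ y : EuclideanSpace ℝ (Fin m), ∀ z t : ℝ,
      ‖y‖ ^ 2 + z ^ 2 = 1 → t ≤ T → z ≤ t → u₁ ((y, z), t) = u₂ ((y, z), t)) :
    q₁ = q₂ := by
  have hsupp₁ : ∀ x : Sp m, 1 < normSq x → q₁ x = 0 := fun x => hq₁supp x.1 x.2
  have hsupp₂ : ∀ x : Sp m, 1 < normSq x → q₂ x = 0 := fun x => hq₂supp x.1 x.2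
  have hInt₁ := integrable_slice hq₁.continuous hsupp₁
  have hInt₂ := integrable_slice hq₂.continuous hsupp₂
  set q : Sp m → ℝ := fun x => q₁ x - q₂ x with hqdef
  have hq : Continuous q := hq₁.continuous.sub hq₂.continuous
  have hsupp : ∀ x, 1 < normSq x → q x = 0 := fun x hx => by simp [q, hsupp₁ x hx, hsupp₂ x hx]
  have hInt := integrable_slice hq hsupp
  have hU₁ := smoothHalf_shift hu₁_smooth
  have hU₂ := smoothHalf_shift hu₂_smooth
  set U : SpT m → ℝ := fun p => shift u₁ p - shift u₂ p with hUdef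
  have hU : SmoothHalf U := hU₁.sub hU₂
  have hlop : ∀ (u : SpT m → ℝ) (r : Sp m → ℝ), SmoothHalf (shift u) →
      (∀ p : SpT m, p.1.2 < p.2 → waveOp m u p + r p.1 * u p = 0) →
      ∀ p : SpT m, 0 < p.2 → Lop (shift u) p = r p.1 * shift u p := by
    intro u r hu h p hp
    have h1 := h (p.1, p.1.2 + p.2) (by simpa using hp)
    rw [waveOp_shift hu hp] at h1
    simp only [shift] at h1 ⊢
    linarith
  have hL : ∀ p : SpT m, 0 < p.2 → Lop U p = q₁ p.1 * U p + q p.1 * shift u₂ p := by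
    intro p hp
    rw [hUdef, Lop_sub hU₁ hU₂ hp, hlop u₁ q₁ hU₁ hu₁_pde p hp, hlop u₂ q₂ hU₂ hu₂_pde p hp]
    simp only [q]
    ring
  have hchar : ∀ x : Sp m, U (x, 0) = -(1 / 2) * ∫ s in Set.Iic x.2, q (x.1, s) := by
    intro x
    have h1 := hu₁_char x.1 x.2
    have h2 := hu₂_char x.1 x.2
    simp only [U, shift, add_zero, q]
    rw [integral_sub (hInt₁ x.1).integrableOn (hInt₂ x.1).integrableOn, h1, h2]
    ring
  have hanti := fun y : EuclideanSpace ℝ (Fin m) =>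
    antideriv_vanishing (f := fun s => q (y, s)) (c := ‖y‖ ^ 2) (hInt y)
      (fun s => by simp only [q]; rw [hq₁even, hq₂even]) (fun s hs => hsupp (y, s) hs)
      (fun z hz => by
        have h1 := hchar (y, z)
        have h2 := hdata y z z hz (by nlinarith [sq_nonneg ‖y‖]) le_rfl
        simp only [U, shift, add_zero, h2, sub_self] at h1
        linarith)
  have hinit : ∀ x : Sp m, 1 ≤ normSq x → U (x, 0) = 0 := fun x hx => by
    rw [hchar, (hanti x.1).1 x.2 hx, mul_zero]
  have hodd : ∀ x : Sp m, U (refl x, 0) = -U (x, 0) := fun x => by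
    rw [hchar, hchar]
    have := (hanti x.1).2 x.2
    simp only [FixedAngle.refl, this]
    ring
  have htrace : ∀ x : Sp m, D ez U (x, 0) = -(1 / 2) * q x := by
    intro x
    refine hU.D_eq_horizontal (p := (x, 0)) le_rfl ?_
    have h := (hasDerivAt_integral_Iic (hInt x.1) (by fun_prop) x.2).const_mul (-(1 / 2))
    have h1 : HasDerivAt (fun r : ℝ => x.2 + r) 1 0 := by
      simpa using (hasDerivAt_id (0 : ℝ)).const_add x.2
    have h2 : HasDerivAt (fun z => -(1 / 2) * ∫ s in Set.Iic z, q (x.1, s))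
      (-(1 / 2) * q x) (x.2 + 0) := by simpa using h
    have h3 := HasDerivAt.comp (h := fun r : ℝ => x.2 + r) 0 h2 h1
    rw [mul_one] at h3
    refine h3.congr_of_eventuallyEq (Filter.Eventually.of_forall fun r => ?_)
    have h4 := hchar (x + r • ((0, 1) : Sp m))
    simpa using h4
  have hext : ∀ p ∈ halfSpace (Sp m), 1 ≤ normSq p.1 → p.1.2 + p.2 < 6 → U p = 0 := by
    intro p hp h1 h6
    refine exterior_vanishing (T := T) (by linarith) hU (fun p hp hn => ?_) hinit
      (fun p hp h => ?_) (fun p hp hn ht => ?_) hp h1 (by linarith)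
    · rw [hL p hp, hsupp₁ _ hn, hsupp _ hn]; ring
    · have hp' : p.1.2 ≤ p.1.2 + p.2 := le_add_of_nonneg_right hp
      simp only [U, shift]
      rw [hu₁_ic p.1.1 p.1.2 _ hp' h, hu₂_ic p.1.1 p.1.2 _ hp' h, sub_zero]
    · have hp' : p.1.2 ≤ p.1.2 + p.2 := le_add_of_nonneg_right hp
      simp only [U, shift]
      rw [hdata p.1.1 p.1.2 _ hn ht hp', sub_self]
  funext x
  exact sub_eq_zero.1
    (halfspace_uniqueness hU hU₂ hq hq₁.continuous hsupp hL hext hinit hodd htrace x)
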